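/- arXiv:2210.04054 — 6 statements merged into one kernel-verified Lean document; each statement's English description precedes it below -/
import Mathlib

section
/- Let n ≥ 1 and 0 ≤ r ≤ n be integers. Let e₀, e₁, …, e_n denote the standard basis of ℤ^{n+1}, and let σ : ℤ^{n+1} → ℤ^{n+1} be the group homomorphism determined by σ(e₀) = e₀ + e₁ + ⋯ + e_n and σ(e_i) = −e_{n+1−i} for 1 ≤ i ≤ n. Define λ̃ ∈ ℤ^{n+1} by λ̃ = e₀ + e_{n/2+1} if n is even and r is odd, and λ̃ = e₀ otherwise. Then the number of subsets J ⊆ {1, …, n} with |J| = r such that e₀ + Σ_{i∈J} e_i − λ̃ lies in the subgroup (id − σ)(ℤ^{n+1}) equals the binomial coefficient C(n/2 − 1, (r−1)/2) if n is even and r is odd, and equals C(⌊n/2⌋, ⌊r/2⌋) otherwise. -/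
lemma aux_card (n k : ℕ) (hk : 2 * k ≤ n) (S A m : Finset ℕ)
    (hA : ∀ x ∈ A, 1 ≤ x ∧ x ≤ k) (hm : ∀ x ∈ m, k < x ∧ x < n + 1 - k)
    (hS : ∀ x, x ∈ S ↔ x ∈ A ∨ x ∈ m ∨ (x ≤ n ∧ n + 1 - x ∈ A)) :
    S.card = 2 * A.card + m.card := by
  have h1 : S = (A ∪ m) ∪ A.image (fun x => n + 1 - x) := by
    ext x
    rw [hS]
    simp only [Finset.mem_union, Finset.mem_image]
    constructor
    · rintro (h | h | ⟨h, h'⟩)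
      · exact Or.inl (Or.inl h)
      · exact Or.inl (Or.inr h)
      · exact Or.inr ⟨_, h', by omega⟩
    · rintro ((h | h) | ⟨y, h, rfl⟩)
      · exact Or.inl h
      · exact Or.inr (Or.inl h)
      · have := hA y h
        refine Or.inr (Or.inr ⟨by omega, ?_⟩)
        rwa [show n + 1 - (n + 1 - y) = y by omega]
  rw [h1, Finset.card_union_of_disjoint, Finset.card_union_of_disjoint, Finset.card_image_of_injOn]
  · ring
  · intro x hx y hy h
    have := hA x hx
    have := hA y hy
    simp only at h
    omega
  · rw [Finset.disjoint_left]
    intro x hx hx'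
    have := hA x hx
    have := hm x hx'
    omega
  · rw [Finset.disjoint_left]
    intro x hx hx'
    obtain ⟨y, hy, rfl⟩ := Finset.mem_image.1 hx'
    have := hA y hy
    rcases Finset.mem_union.1 hx with h | h
    · have := hA _ h
      omega
    · have := hm _ h
      omega

lemma aux_count (n k t : ℕ) (hk : 2 * k ≤ n) (m : Finset ℕ)
    (hm : ∀ x ∈ m, k < x ∧ x < n + 1 - k) (P : Finset (Fin (n + 1)) → Prop)
    (hP : ∀ J, P J ↔ J.card = 2 * t + m.card ∧ ∀ i : Fin (n + 1), i ∈ J ↔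
      ((i : ℕ) ∈ m ∨ ((i : ℕ) ∈ (J.image Fin.val).filter (fun x => 1 ≤ x ∧ x ≤ k)) ∨
        (n + 1 - (i : ℕ)) ∈ (J.image Fin.val).filter (fun x => 1 ≤ x ∧ x ≤ k))) :
    Nat.card {J : Finset (Fin (n + 1)) // P J} = Nat.choose k t := by
  classical
  have hc : ∀ (J : Finset (Fin (n + 1))) (A : Finset ℕ), (∀ x ∈ A, 1 ≤ x ∧ x ≤ k) →
      (∀ i : Fin (n + 1), i ∈ J ↔ ((i : ℕ) ∈ m ∨ (i : ℕ) ∈ A ∨ (n + 1 - (i : ℕ)) ∈ A)) →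
      J.card = 2 * A.card + m.card ∧ (J.image Fin.val).filter (fun x => 1 ≤ x ∧ x ≤ k) = A := by
    intro J A hA hJ
    constructor
    · rw [← Finset.card_image_of_injective J Fin.val_injective]
      apply aux_card n k hk _ A m hA hm
      intro x
      simp only [Finset.mem_image]
      constructor
      · rintro ⟨i, hi, rfl⟩
        have := (hJ i).1 hi
        have := i.2
        rcases (hJ i).1 hi with h | h | h
        · tauto
        · tauto
        · exact Or.inr (Or.inr ⟨by omega, h⟩)
      · intro h
        have hx : x < n + 1 := by
          rcases h with h | h | h
          · have := hA x h; omega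
          · have := hm x h; omega
          · omega
        refine ⟨⟨x, hx⟩, (hJ _).2 ?_, rfl⟩
        simp only
        tauto
    · ext x
      simp only [Finset.mem_filter, Finset.mem_image]
      constructor
      · rintro ⟨⟨i, hi, rfl⟩, h1, h2⟩
        rcases (hJ i).1 hi with h | h | h
        · have := hm _ h; omega
        · exact h
        · have := hA _ h; omega
      · intro h
        have h' := hA x h
        exact ⟨⟨⟨x, by omega⟩, (hJ _).2 (Or.inr (Or.inl h)), rfl⟩, h'⟩
  rw [Nat.card_eq_fintype_card, Fintype.card_subtype]
  have : Nat.choose k t = (Finset.powersetCard t (Finset.Icc 1 k)).card := by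
    simp
  rw [this]
  have hA' : ∀ (J : Finset (Fin (n + 1))),
      ∀ x ∈ (J.image Fin.val).filter (fun x => 1 ≤ x ∧ x ≤ k), 1 ≤ x ∧ x ≤ k := by
    intro J x hx
    exact (Finset.mem_filter.1 hx).2
  apply Finset.card_bij' (fun J _ => (J.image Fin.val).filter (fun x => 1 ≤ x ∧ x ≤ k))
    (fun A _ => Finset.univ.filter (fun i : Fin (n + 1) =>
      ((i : ℕ) ∈ m ∨ (i : ℕ) ∈ A ∨ (n + 1 - (i : ℕ)) ∈ A)))
  · intro J hJ
    have hJ' := (hP J).1 (Finset.mem_filter.1 hJ).2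
    have := (hc J _ (hA' J) hJ'.2).1
    rw [Finset.mem_powersetCard]
    refine ⟨fun x hx => Finset.mem_Icc.2 (hA' J x hx), by omega⟩
  · intro A hA
    rw [Finset.mem_powersetCard] at hA
    have h := hc (Finset.univ.filter (fun i : Fin (n + 1) =>
      ((i : ℕ) ∈ m ∨ (i : ℕ) ∈ A ∨ (n + 1 - (i : ℕ)) ∈ A))) A
      (fun x hx => Finset.mem_Icc.1 (hA.1 hx)) (by simp)
    simp only [Finset.mem_filter, Finset.mem_univ, true_and]
    rw [hP, h.2, h.1, hA.2]
    simp
  · intro J hJ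
    have hJ' := (hP J).1 (Finset.mem_filter.1 hJ).2
    ext i
    rw [hJ'.2 i]
    simp only [Finset.mem_filter, Finset.mem_univ, true_and]
  · intro A hA
    rw [Finset.mem_powersetCard] at hA
    exact (hc _ A (fun x hx => Finset.mem_Icc.1 (hA.1 hx)) (by simp)).2

lemma aux_sigma (n : ℕ) 
    (σ : (Fin (n + 1) → ℤ) →+ (Fin (n + 1) → ℤ))
    (hσ0 : σ (Pi.single 0 1) = fun _ => 1)
    (hσi : ∀ i : Fin (n + 1), ∀ hi : 1 ≤ (i : ℕ),
      σ (Pi.single i 1) =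
        -Pi.single (⟨n + 1 - (i : ℕ), Nat.sub_lt (Nat.succ_pos n) hi⟩ : Fin (n + 1)) 1)
    (x : Fin (n + 1) → ℤ) :
    σ x 0 = x 0 ∧ ∀ i : Fin (n + 1), ∀ hi : 1 ≤ (i : ℕ),
      σ x i = x 0 - x ⟨n + 1 - (i : ℕ), Nat.sub_lt (Nat.succ_pos n) hi⟩ := by
  have hx : σ x = ∑ i, x i • σ (Pi.single i 1) := by
    conv_lhs => rw [pi_eq_sum_univ' x]
    rw [map_sum]
    refine Finset.sum_congr rfl fun i _ => ?_
    rw [← map_zsmul]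
  rw [hx, Fin.sum_univ_succ, hσ0]
  simp only [Finset.sum_apply, Pi.add_apply, Pi.smul_apply, smul_eq_mul, mul_one]
  have h : ∀ i : Fin n, σ (Pi.single i.succ 1) = -Pi.single i.rev.succ 1 := by
    intro i
    rw [hσi i.succ (by simp)]
    congr 2
    ext
    simp [Fin.val_rev]
    omega
  simp only [h, Pi.neg_apply]
  constructor
  · simp [Pi.single_apply, Fin.ext_iff]
  · intro i hi
    obtain ⟨j, rfl⟩ := Fin.exists_succ_eq.2 (show i ≠ 0 by rintro rfl; simp at hi)
    rw [Finset.sum_eq_single j.rev]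
    · have : (⟨n + 1 - (j.succ : ℕ), Nat.sub_lt (Nat.succ_pos n) hi⟩ : Fin (n + 1)) = j.rev.succ := by
        ext
        simp [Fin.val_rev]
        omega
      rw [this]
      simp
      ring
    · intro b _ hb
      have : j ≠ b.rev := by
        rintro rfl
        simp at hb
      simp [Pi.single_apply, this]
    · simp

lemma aux_range (n : ℕ) 
    (σ : (Fin (n + 1) → ℤ) →+ (Fin (n + 1) → ℤ))
    (hσ0 : σ (Pi.single 0 1) = fun _ => 1)
    (hσi : ∀ i : Fin (n + 1), ∀ hi : 1 ≤ (i : ℕ),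
      σ (Pi.single i 1) =
        -Pi.single (⟨n + 1 - (i : ℕ), Nat.sub_lt (Nat.succ_pos n) hi⟩ : Fin (n + 1)) 1)
    (y : Fin (n + 1) → ℤ) :
    y ∈ (AddMonoidHom.id (Fin (n + 1) → ℤ) - σ).range ↔
    y 0 = 0 ∧ ∀ i j : Fin (n + 1), (i : ℕ) + j = n + 1 → y i = y j := by
  have hs := aux_sigma n σ hσ0 hσi
  constructor
  · rintro ⟨x, rfl⟩
    refine ⟨by simp [(hs x).1], fun i j h => ?_⟩
    have h1 := (hs x).2 i (by omega)
    have h2 := (hs x).2 j (by omega)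
    rw [show (⟨n + 1 - (i : ℕ), Nat.sub_lt (Nat.succ_pos n) (by omega)⟩ : Fin (n + 1)) = j by
      ext; simp; omega] at h1
    rw [show (⟨n + 1 - (j : ℕ), Nat.sub_lt (Nat.succ_pos n) (by omega)⟩ : Fin (n + 1)) = i by
      ext; simp; omega] at h2
    simp only [AddMonoidHom.sub_apply, AddMonoidHom.id_apply, Pi.sub_apply, h1, h2]
    ring
  · rintro ⟨h0, h⟩
    obtain ⟨c, hc⟩ : ∃ c : ℤ, ∀ i : Fin (n + 1), 2 * (i : ℕ) = n + 1 → y i = -c := by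
      by_cases hn : ∃ i : Fin (n + 1), 2 * (i : ℕ) = n + 1
      · obtain ⟨i, hi⟩ := hn
        refine ⟨-y i, fun j hj => ?_⟩
        rw [show j = i by ext; omega]
        simp
      · exact ⟨0, fun i hi => absurd ⟨i, hi⟩ hn⟩
    set x : Fin (n + 1) → ℤ := fun i => if (i : ℕ) = 0 then c else
      if 2 * (i : ℕ) < n + 1 then y i + c else 0 with hxdef
    have hx0 : x 0 = c := by simp [hxdef]
    refine ⟨x, ?_⟩
    ext i
    simp only [AddMonoidHom.sub_apply, AddMonoidHom.id_apply, Pi.sub_apply]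
    by_cases hi : (i : ℕ) = 0
    · have : i = 0 := by ext; simpa using hi
      subst this
      rw [(hs x).1, h0]
      ring
    · rw [(hs x).2 i (by omega), hx0]
      generalize hj : (⟨n + 1 - (i : ℕ), Nat.sub_lt (Nat.succ_pos n) (by omega)⟩ : Fin (n + 1)) = j
      have hj' : n + 1 - (i : ℕ) = j := by rw [← hj]
      have hij : (i : ℕ) + j = n + 1 := by omega
      have hy := h i j hij
      have hj0 : (j : ℕ) ≠ 0 := by omega
      simp only [hxdef, hi, hj0, if_false]
      rcases lt_trichotomy (2 * (i : ℕ)) (n + 1) with h1 | h1 | h1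
      · rw [if_pos h1, if_neg (by omega)]; ring
      · rw [if_neg (by omega), if_neg (by omega), hc i h1]; ring
      · rw [if_neg (by omega), if_pos (by omega), hy]; ring


set_option maxHeartbeats 1000000 in
/-- **Counting `J_b(ℚ_p)`-orbits of irreducible components of the basic ADLV for
`GU(n)` at an inert prime** (Proposition `Orbits` + Lemma `apx:1`).

`σ : ℤ^{n+1} → ℤ^{n+1}` is the additive map with `σ(e₀) = e₀ + ⋯ + e_n` and
`σ(e_i) = -e_{n+1-i}` for `1 ≤ i ≤ n`; `λ̃ = e₀ + e_{n/2+1}` if `n` is even and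
`r` is odd, and `λ̃ = e₀` otherwise.  The number of subsets `J ⊆ {1, …, n}` of
cardinality `r` with `e₀ + ∑_{i ∈ J} e_i - λ̃ ∈ (id - σ)(ℤ^{n+1})` is
`C(n/2 - 1, (r-1)/2)` if `n` is even and `r` is odd, and `C(⌊n/2⌋, ⌊r/2⌋)`
otherwise. -/
theorem count_weights_in_coinvariant_class
    (n r : ℕ) (hn : 1 ≤ n) (hr : r ≤ n)
    (σ : (Fin (n + 1) → ℤ) →+ (Fin (n + 1) → ℤ))
    (hσ0 : σ (Pi.single 0 1) = fun _ => 1)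
    (hσi : ∀ i : Fin (n + 1), ∀ hi : 1 ≤ (i : ℕ),
      σ (Pi.single i 1) =
        -Pi.single (⟨n + 1 - (i : ℕ), Nat.sub_lt (Nat.succ_pos n) hi⟩ : Fin (n + 1)) 1)
    (lam : Fin (n + 1) → ℤ)
    (hlam : lam = if Even n ∧ Odd r then
        Pi.single 0 1 + Pi.single (⟨n / 2 + 1, by omega⟩ : Fin (n + 1)) 1
      else Pi.single 0 1) :
    Nat.card {J : Finset (Fin (n + 1)) //
        (0 : Fin (n + 1)) ∉ J ∧ J.card = r ∧
        (Pi.single 0 1 + ∑ i ∈ J, Pi.single i 1) - lam ∈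
          (AddMonoidHom.id (Fin (n + 1) → ℤ) - σ).range } =
      if Even n ∧ Odd r then Nat.choose (n / 2 - 1) ((r - 1) / 2)
      else Nat.choose (n / 2) (r / 2) := by
  have hv : ∀ (J : Finset (Fin (n + 1))) (j : Fin (n + 1)),
      (∑ i ∈ J, (Pi.single i 1 : Fin (n + 1) → ℤ)) j = if j ∈ J then 1 else 0 := by
    intro J j
    simp [Finset.sum_apply, Pi.single_apply]
  have hmem : ∀ (J : Finset (Fin (n + 1))) (x k : ℕ),
      x ∈ (J.image Fin.val).filter (fun x => 1 ≤ x ∧ x ≤ k) ↔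
      (∃ h : x < n + 1, (⟨x, h⟩ : Fin (n + 1)) ∈ J) ∧ 1 ≤ x ∧ x ≤ k := by
    intro J x k
    rw [Finset.mem_filter, Finset.mem_image]
    refine and_congr_left fun _ => ⟨?_, ?_⟩
    · rintro ⟨i, hi, rfl⟩
      exact ⟨i.2, hi⟩
    · rintro ⟨h, h'⟩
      exact ⟨_, h', rfl⟩
  simp only [aux_range n σ hσ0 hσi]
  split_ifs at hlam ⊢ with hc
  · obtain ⟨⟨a, ha⟩, ⟨b, hb⟩⟩ := hc
    apply aux_count n (n / 2 - 1) ((r - 1) / 2) (by omega) {n / 2 + 1} (by simp; omega)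
    intro J
    rw [show 2 * ((r - 1) / 2) + ({n / 2 + 1} : Finset ℕ).card = r by simp; omega]
    have hy : ∀ j : Fin (n + 1), ((Pi.single 0 1 + ∑ i ∈ J, Pi.single i 1) - lam : Fin (n + 1) → ℤ) j
        = (if j ∈ J then 1 else 0) - (if (j : ℕ) = n / 2 + 1 then 1 else 0) := by
      intro j
      rw [hlam]
      simp only [Pi.sub_apply, Pi.add_apply, hv]
      rw [Pi.single_apply (⟨n / 2 + 1, _⟩ : Fin (n + 1))]
      simp only [Fin.ext_iff]
      ring
    simp only [hy, hmem, Finset.mem_singleton]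
    constructor
    · rintro ⟨h0, hr', -, hsym⟩
      refine ⟨hr', fun i => ?_⟩
      by_cases hi : (i : ℕ) = 0
      · have : i = 0 := by ext; simpa using hi
        subst this
        simp [h0]
      · have hs := hsym i ⟨n + 1 - i, by omega⟩ (by dsimp only; omega)
        have := i.2
        simp only at hs
        have e1 : (∃ h : (i : ℕ) < n + 1, (⟨i, h⟩ : Fin (n + 1)) ∈ J) ↔ i ∈ J :=
          ⟨fun ⟨_, h⟩ => h, fun h => ⟨i.2, h⟩⟩
        have e2 : (∃ h : n + 1 - (i : ℕ) < n + 1, (⟨n + 1 - i, h⟩ : Fin (n + 1)) ∈ J) ↔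
          (⟨n + 1 - i, by omega⟩ : Fin (n + 1)) ∈ J :=
            ⟨fun ⟨_, h⟩ => h, fun h => ⟨by omega, h⟩⟩
        rw [e1, e2]
        clear e1 e2 hsym hy hmem hv hσ0 hσi hlam
        by_cases hp : i ∈ J <;> by_cases hq : (⟨n + 1 - i, by omega⟩ : Fin (n + 1)) ∈ J <;>
          simp only [hp, hq, true_iff, false_iff, true_and, false_and, or_false, false_or,
            if_true, if_false] at hs ⊢ <;> split_ifs at hs <;> omega
    · rintro ⟨hr', hJ⟩
      have h0 : (0 : Fin (n + 1)) ∉ J := by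
        rw [hJ]
        simp
      refine ⟨h0, hr', by simp [h0], fun i j hij => ?_⟩
      have hi := hJ i
      have hj := hJ j
      rw [show n + 1 - (i : ℕ) = j by omega] at hi
      rw [show n + 1 - (j : ℕ) = i by omega] at hj
      simp only [Fin.eta, Fin.is_lt, exists_true_left] at hi hj
      have := i.2
      have := j.2
      by_cases h1 : i ∈ J <;> by_cases h2 : j ∈ J <;> simp only [h1, h2, true_iff, false_iff, true_and, false_and, if_true, if_false, or_false, false_or] at hi hj ⊢ <;> split_ifs <;> omega
  · have hpar : n % 2 = 1 ∨ r % 2 = 0 := by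
      rw [Nat.even_iff, Nat.odd_iff] at hc
      omega
    apply aux_count n (n / 2) (r / 2) (by omega) (if r % 2 = 1 then {n / 2 + 1} else ∅)
      (by split_ifs <;> simp; omega)
    intro J
    rw [show 2 * (r / 2) + (if r % 2 = 1 then {n / 2 + 1} else ∅ : Finset ℕ).card = r by
      split_ifs <;> simp <;> omega]
    have hm' : ∀ x, x ∈ (if r % 2 = 1 then {n / 2 + 1} else ∅ : Finset ℕ) ↔
        r % 2 = 1 ∧ x = n / 2 + 1 := by
      intro x
      split_ifs with h <;> simp [h]
    have hy : ∀ j : Fin (n + 1), ((Pi.single 0 1 + ∑ i ∈ J, Pi.single i 1) - lam : Fin (n + 1) → ℤ) j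
        = (if j ∈ J then 1 else 0) := by
      intro j
      rw [hlam]
      simp only [Pi.sub_apply, Pi.add_apply, hv]
      ring
    have hiff : ∀ i j : Fin (n + 1),
        ((if i ∈ J then 1 else 0 : ℤ) = if j ∈ J then 1 else 0) ↔ (i ∈ J ↔ j ∈ J) := by
      intro i j
      split_ifs <;> simp_all
    simp only [hy, hmem, hm', hiff]
    constructor
    · rintro ⟨h0, hr', -, hsym⟩
      refine ⟨hr', ?_⟩
      have hcard := aux_card n (n / 2) (by omega) (J.image Fin.val)
        ((J.image Fin.val).filter (fun x => 1 ≤ x ∧ x ≤ n / 2))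
        ((J.image Fin.val).filter (fun x => 2 * x = n + 1))
        (fun x hx => (Finset.mem_filter.1 hx).2)
        (fun x hx => by have := (Finset.mem_filter.1 hx).2; omega)
        (by
          intro x
          rw [hmem, hmem, Finset.mem_filter, Finset.mem_image]
          constructor
          · rintro ⟨i, hi, rfl⟩
            have hi0 : (i : ℕ) ≠ 0 := by
              intro h
              apply h0
              rwa [show (0 : Fin (n + 1)) = i by ext; simpa using h.symm]
            have := i.2
            have hs := (hsym i ⟨n + 1 - i, by omega⟩ (by dsimp only; omega)).1 hi
            rcases lt_trichotomy (2 * (i : ℕ)) (n + 1) with h | h | h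
            · exact Or.inl ⟨⟨i.2, hi⟩, by omega, by omega⟩
            · exact Or.inr (Or.inl ⟨⟨i, hi, rfl⟩, h⟩)
            · exact Or.inr (Or.inr ⟨by omega, ⟨by omega, hs⟩, by omega, by omega⟩)
          · rintro (⟨⟨h, h'⟩, -⟩ | ⟨h, -⟩ | ⟨h1, ⟨h2, h3⟩, h4⟩)
            · exact ⟨_, h', rfl⟩
            · exact h
            · exact ⟨⟨x, by omega⟩, (hsym _ _ (by simp; omega)).1 h3, rfl⟩)
      rw [Finset.card_image_of_injective J Fin.val_injective, hr'] at hcard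
      have hmid : ∀ i : Fin (n + 1), 2 * (i : ℕ) = n + 1 → (i ∈ J ↔ r % 2 = 1) := by
        intro i hi
        have : (J.image Fin.val).filter (fun x => 2 * x = n + 1) =
            if i ∈ J then {(i : ℕ)} else ∅ := by
          ext x
          rw [Finset.mem_filter, Finset.mem_image]
          constructor
          · rintro ⟨⟨j, hj, rfl⟩, h⟩
            have : j = i := by ext; omega
            subst this
            simp [hj]
          · intro h
            split_ifs at h with h'
            · rw [Finset.mem_singleton] at h
              subst h
              exact ⟨⟨i, h', rfl⟩, hi⟩
            · simp at h
        rw [this] at hcard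
        split_ifs at hcard with h' <;> simp [h'] at hcard ⊢ <;> omega
      intro i
      by_cases hi : (i : ℕ) = 0
      · have : i = 0 := by ext; simpa using hi
        subst this
        simp [h0]
      · have hs := hsym i ⟨n + 1 - i, by omega⟩ (by dsimp only; omega)
        have := i.2
        have hmi := hmid i
        have e1 : (∃ h : (i : ℕ) < n + 1, (⟨i, h⟩ : Fin (n + 1)) ∈ J) ↔ i ∈ J :=
          ⟨fun ⟨_, h⟩ => h, fun h => ⟨i.2, h⟩⟩
        have e2 : (∃ h : n + 1 - (i : ℕ) < n + 1, (⟨n + 1 - i, h⟩ : Fin (n + 1)) ∈ J) ↔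
          i ∈ J := by
            rw [hs]
            exact ⟨fun ⟨_, h⟩ => h, fun h => ⟨by omega, h⟩⟩
        rw [e1, e2]
        clear e1 e2 hs hcard hsym
        by_cases h : i ∈ J <;> simp only [h, true_iff, false_iff, true_and, false_and, or_false] at hmi ⊢ <;> omega
    · rintro ⟨hr', hJ⟩
      have h0 : (0 : Fin (n + 1)) ∉ J := by
        rw [hJ]
        simp
      refine ⟨h0, hr', by simp [h0], fun i j hij => ?_⟩
      have hi := hJ i
      have hj := hJ j
      rw [show n + 1 - (i : ℕ) = j by omega] at hi
      rw [show n + 1 - (j : ℕ) = i by omega] at hj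
      simp only [Fin.eta, Fin.is_lt, exists_true_left] at hi hj
      have := i.2
      have := j.2
      by_cases h1 : i ∈ J <;> by_cases h2 : j ∈ J <;> simp only [h1, h2, true_iff, false_iff, true_and, false_and, or_false, false_or] at hi hj ⊢ <;> omega
end

section
/- Let p be a prime, q a power of p, and n ≥ 1 an integer. Let H ⊂ ℙ^n be the Fermat hypersurface over 𝔽_{q²} defined by the equation X₀^{q+1} + X₁^{q+1} + ⋯ + X_n^{q+1} = 0. Then the number of 𝔽_{q²}-rational points of H is |H(𝔽_{q²})| = (q^{n+1} + (−1)^n)(q^n + (−1)^{n+1}) / (q² − 1). Equivalently, the number of nonzero vectors v = (v₀, …, v_n) ∈ 𝔽_{q²}^{n+1} with v₀^{q+1} + ⋯ + v_n^{q+1} = 0 equals (q^{n+1} + (−1)^n)(q^n + (−1)^{n+1}). -/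
open Polynomial in
lemma fermat_fiber_card {K : Type*} [Field K] [Fintype K] [DecidableEq K] (q : ℕ) (hq : 2 ≤ q)
    (hK : Fintype.card K = q ^ 2) (a : K) (ha : a ≠ 0) (haq : a ^ q = a) :
    (Finset.univ.filter (fun x : K => x ^ (q + 1) = a)).card = q + 1 := by
  classical
  obtain ⟨r, rfl⟩ : ∃ r, q = r + 1 := ⟨q - 1, by omega⟩
  have hr : 0 < r := by omega
  obtain ⟨g, hg⟩ := IsCyclic.exists_generator (α := Kˣ)
  have hgo : orderOf g = r * (r + 1 + 1) := by
    rw [orderOf_eq_card_of_forall_mem_zpowers hg, Nat.card_eq_fintype_card, Fintype.card_units, hK]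
    rw [Nat.sub_eq_iff_eq_add (by nlinarith)]; ring
  have hprim : IsPrimitiveRoot (g ^ r) (r + 1 + 1) := by
    exact (IsPrimitiveRoot.orderOf g).pow (by rw [hgo]; positivity) hgo
  have hprim2 : IsPrimitiveRoot ((g ^ r : Kˣ) : K) (r + 1 + 1) :=
    IsPrimitiveRoot.coe_units_iff.2 hprim
  have har : (Units.mk0 a ha) ^ r = 1 := by
    ext
    have : a ^ r * a = 1 * a := by rw [← pow_succ, haq, one_mul]
    simpa using mul_right_cancel₀ ha this
  have hex : ∃ α : K, α ^ (r + 1 + 1) = a := by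
    obtain ⟨k, hk⟩ := (mem_powers_iff_mem_zpowers.2 (hg (Units.mk0 a ha)))
    simp only at hk
    rw [← hk, ← pow_mul] at har
    have h1 := orderOf_dvd_of_pow_eq_one har
    rw [hgo, mul_comm k r] at h1
    obtain ⟨c, rfl⟩ := Nat.dvd_of_mul_dvd_mul_left hr h1
    refine ⟨((g ^ c : Kˣ) : K), ?_⟩
    have := congrArg (fun u : Kˣ => (u : K)) hk
    simp only [Units.val_mk0] at this
    rw [← this]
    push_cast
    rw [← pow_mul, mul_comm]
  have h := hprim2.card_nthRoots a
  rw [if_pos hex] at h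
  have h2 := hprim2.nthRoots_nodup ha
  rw [← Multiset.toFinset_card_of_nodup h2] at h
  refine Eq.trans ?_ h
  congr 1
  ext x
  simp [mem_nthRoots]

lemma fermat_count {K : Type*} [Field K] [Fintype K] [DecidableEq K] (p : ℕ) (hp : p.Prime)
    (m : ℕ) (hm : 0 < m) (hK : Fintype.card K = (p ^ m) ^ 2) (k : ℕ) :
    ((Finset.univ.filter
      (fun v : Fin (k + 1) → K => ∑ i, v i ^ (p ^ m + 1) = 0)).card : ℤ) =
      ((p ^ m : ℕ) : ℤ) ^ (2 * k + 1) + (-1) ^ (k + 1) *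
        (((p ^ m : ℕ) : ℤ) ^ (k + 1) - ((p ^ m : ℕ) : ℤ) ^ k) := by
  have hq2 : 2 ≤ p ^ m := le_trans hp.two_le (Nat.le_self_pow hm.ne' p)
  have : Fact p.Prime := ⟨hp⟩
  have : CharP K p := by
    rw [← pow_mul] at hK
    exact charP_of_card_eq_prime_pow hK
  set q := p ^ m with hqdef
  have hfix : ∀ x : K, (x ^ (q + 1)) ^ q = x ^ (q + 1) := by
    intro x
    have := FiniteField.pow_card x
    rw [hK] at this
    calc (x ^ (q + 1)) ^ q = x ^ (q ^ 2) * x ^ q := by ring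
      _ = _ := by rw [this]; ring
  have hneg : (-1 : K) ^ q = -1 := by
    have := sub_pow_char_pow (R := K) (p := p) (n := m) 0 1
    rw [← hqdef] at this
    simpa [zero_pow (show q ≠ 0 by omega)] using this
  induction k with
  | zero =>
    have : (Finset.univ.filter
      (fun v : Fin (0 + 1) → K => ∑ i, v i ^ (q + 1) = 0)) = {0} := by
      ext v
      simp only [Finset.mem_filter, Finset.mem_univ, true_and, Finset.mem_singleton]
      constructor
      · intro h
        ext i
        fin_cases i
        simpa using h
      · rintro rfl; simp
    rw [this]; simp
  | succ k ih =>
    have key : (Finset.univ.filter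
        (fun v : Fin (k + 1 + 1) → K => ∑ i, v i ^ (q + 1) = 0)).card =
        ∑ w : Fin (k + 1) → K, (Finset.univ.filter
          (fun x : K => x ^ (q + 1) = - ∑ i, w i ^ (q + 1))).card := by
      rw [← Finset.card_sigma]
      refine Finset.card_bij' (fun v _ => ⟨fun i => v i.succ, v 0⟩)
        (fun s _ => Fin.cons s.2 s.1) ?_ ?_ ?_ ?_
      · intro v hv
        simp only [Finset.mem_filter, Finset.mem_univ, true_and, Fin.sum_univ_succ (n := k + 1),
          Finset.mem_sigma] at hv ⊢
        exact eq_neg_of_add_eq_zero_left hv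
      · intro s hs
        simp only [Finset.mem_filter, Finset.mem_univ, true_and, Finset.mem_sigma] at hs ⊢
        rw [Fin.sum_univ_succ]
        simp [hs]
      · intro v hv
        exact Fin.cons_self_tail v
      · intro s hs
        simp
    have hcard : ∀ w : Fin (k + 1) → K, (((Finset.univ.filter
          (fun x : K => x ^ (q + 1) = - ∑ i, w i ^ (q + 1))).card : ℕ) : ℤ) =
          (q + 1) - q * (if ∑ i, w i ^ (q + 1) = 0 then 1 else 0) := by
      intro w
      split_ifs with h
      · rw [h]
        have : (Finset.univ.filter (fun x : K => x ^ (q + 1) = - 0)) = {0} := by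
          ext x; simp
        rw [this]; simp
      · rw [fermat_fiber_card q hq2 hK _ (neg_ne_zero.2 h)]
        · push_cast; ring
        · rw [neg_eq_neg_one_mul, mul_pow, hneg]
          congr 1
          have := sum_pow_char_pow (R := K) p m Finset.univ (fun i => w i ^ (q + 1))
          rw [← hqdef] at this
          rw [this]
          exact Finset.sum_congr rfl fun i _ => hfix _
    rw [key, Nat.cast_sum, Finset.sum_congr rfl fun w _ => hcard w, Finset.sum_sub_distrib,
      ← Finset.mul_sum, Finset.sum_boole, ih]
    simp only [Finset.sum_const, Finset.card_univ, Fintype.card_fun, Fintype.card_fin, hK]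
    simp only [nsmul_eq_mul]
    push_cast
    ring

lemma fermat_proj {K : Type*} [Field K] [Fintype K] (q n : ℕ)
    (hK : Fintype.card K = q ^ 2) :
    Nat.card {v : Fin (n + 1) → K // v ≠ 0 ∧ ∑ i, v i ^ (q + 1) = 0} =
    Nat.card {W : Submodule K (Fin (n + 1) → K) //
          Module.finrank K W = 1 ∧ ∀ v ∈ W, ∑ i, v i ^ (q + 1) = 0} * (q ^ 2 - 1) := by
  classical
  let e : {v : Fin (n + 1) → K // v ≠ 0 ∧ ∑ i, v i ^ (q + 1) = 0} ≃
      Σ W : {W : Submodule K (Fin (n + 1) → K) //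
          Module.finrank K W = 1 ∧ ∀ v ∈ W, ∑ i, v i ^ (q + 1) = 0}, {w : W.1 // w ≠ 0} :=
    Equiv.ofBijective
      (fun v => ⟨⟨Submodule.span K {v.1}, finrank_span_singleton v.2.1, by
          intro u hu
          obtain ⟨c, rfl⟩ := Submodule.mem_span_singleton.1 hu
          simp only [Pi.smul_apply, smul_eq_mul, mul_pow]
          rw [← Finset.mul_sum, v.2.2, mul_zero]⟩,
        ⟨⟨v.1, Submodule.mem_span_singleton_self _⟩, by
          intro h; exact v.2.1 (congrArg Subtype.val h)⟩⟩) (by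
      constructor
      · intro v w h
        have := congrArg (fun s : (Σ W : {W : Submodule K (Fin (n + 1) → K) //
          Module.finrank K W = 1 ∧ ∀ v ∈ W, ∑ i, v i ^ (q + 1) = 0}, {w : W.1 // w ≠ 0}) =>
            (s.2.1 : Fin (n + 1) → K)) h
        exact Subtype.ext this
      · rintro ⟨⟨W, hW1, hW2⟩, ⟨⟨w, hw⟩, hw0⟩⟩
        have hw0' : w ≠ 0 := fun h => hw0 (Subtype.ext h)
        refine ⟨⟨w, hw0', hW2 w hw⟩, ?_⟩
        have hs : Submodule.span K {w} = W := by
          apply Submodule.eq_of_le_of_finrank_eq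
          · simpa using hw
          · rw [hW1, finrank_span_singleton hw0']
        subst hs
        rfl)
  rw [Nat.card_congr e, Nat.card_sigma]
  rw [Finset.sum_congr rfl (g := fun _ => q ^ 2 - 1)]
  · simp [Nat.card_eq_fintype_card]
  · rintro ⟨W, hW1, hW2⟩ -
    rw [Nat.card_eq_fintype_card, Fintype.card_subtype_compl, Fintype.card_subtype_eq,
      Module.card_eq_pow_finrank (K := K), hW1, hK, pow_one]

/-- **Point count of the Fermat hypersurface of degree `q+1` over `𝔽_{q²}`**
(Lemma `lm:C(Fp2)`).

Let `q` be a power of a prime `p` and `K` a field with `q²` elements.  The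
Fermat hypersurface `H ⊂ ℙⁿ` over `K` defined by `X₀^{q+1} + ⋯ + X_n^{q+1} = 0`
satisfies `|H(𝔽_{q²})| = (q^{n+1} + (-1)^n)(q^n + (-1)^{n+1})/(q² - 1)`;
equivalently, the number of nonzero solution vectors in `K^{n+1}` equals
`(q^{n+1} + (-1)^n)(q^n + (-1)^{n+1})`.  Projective points are identified with
one-dimensional `K`-subspaces of `K^{n+1}` all of whose elements are solutions
(the equation being homogeneous of degree `q+1`). -/
theorem fermat_hypersurface_point_count
    (p : ℕ) (hp : p.Prime) (q : ℕ) (hq : ∃ m : ℕ, 0 < m ∧ q = p ^ m)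
    (n : ℕ) (hn : 1 ≤ n)
    (K : Type*) [Field K] [Fintype K] (hK : Fintype.card K = q ^ 2) :
    ((q : ℤ) ^ 2 - 1) *
        (Nat.card {W : Submodule K (Fin (n + 1) → K) //
          Module.finrank K W = 1 ∧ ∀ v ∈ W, ∑ i, v i ^ (q + 1) = 0} : ℤ) =
      ((q : ℤ) ^ (n + 1) + (-1) ^ n) * ((q : ℤ) ^ n + (-1) ^ (n + 1)) ∧
    (Nat.card {v : Fin (n + 1) → K //
          v ≠ 0 ∧ ∑ i, v i ^ (q + 1) = 0} : ℤ) =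
      ((q : ℤ) ^ (n + 1) + (-1) ^ n) * ((q : ℤ) ^ n + (-1) ^ (n + 1)) := by
  classical
  obtain ⟨m, hm, rfl⟩ := hq
  have h2 : (Nat.card {v : Fin (n + 1) → K //
          v ≠ 0 ∧ ∑ i, v i ^ (p ^ m + 1) = 0} : ℤ) =
      (((p ^ m : ℕ) : ℤ) ^ (n + 1) + (-1) ^ n) * (((p ^ m : ℕ) : ℤ) ^ n + (-1) ^ (n + 1)) := by
    have h := fermat_count p hp m hm hK n
    have h3 : Nat.card {v : Fin (n + 1) → K // v ≠ 0 ∧ ∑ i, v i ^ (p ^ m + 1) = 0} + 1 =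
        (Finset.univ.filter
          (fun v : Fin (n + 1) → K => ∑ i, v i ^ (p ^ m + 1) = 0)).card := by
      rw [Nat.card_eq_fintype_card, Fintype.card_subtype]
      rw [← Finset.card_erase_add_one (a := (0 : Fin (n + 1) → K)) (s := Finset.univ.filter
          (fun v : Fin (n + 1) → K => ∑ i, v i ^ (p ^ m + 1) = 0)) (by simp)]
      congr 2
      ext v
      simp
    rw [← h3] at h
    push_cast at h ⊢
    have h4 : ((-1 : ℤ) ^ n) * (-1) ^ n = 1 := by rw [← mul_pow]; simp
    linear_combination h + h4
  refine ⟨?_, h2⟩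
  rw [← h2, fermat_proj (p ^ m) n hK]
  have : 1 ≤ (p ^ m) ^ 2 := Nat.one_le_pow _ _ (pow_pos hp.pos m)
  push_cast [this]
  ring
end

section
/- Let p be a prime, q a power of p, and n ≥ 1 an integer. Then the number of tuples (x₀, …, x_{n−1}) ∈ 𝔽_{q²}^n satisfying x₀^{q+1} + x₁^{q+1} + ⋯ + x_{n−1}^{q+1} + 1 = 0 equals q^{2n−1} + (−q)^{n−1}. -/
open Classical in
theorem aff_count_norm (q : ℕ) (hq : 2 ≤ q)
    (K : Type*) [Field K] [Fintype K] (hK : Fintype.card K = q ^ 2)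
    (c : K) (hc : c ^ q = c) :
    (∑ y : K, if y ^ (q + 1) = c then (1 : ℤ) else 0) = if c = 0 then 1 else (q : ℤ) + 1 := by
  by_cases h0 : c = 0
  · subst h0
    simp
  · rw [if_neg h0]
    obtain ⟨r, rfl⟩ : ∃ r, q = r + 1 := ⟨q - 1, by omega⟩
    have hr : 0 < r := by omega
    obtain ⟨g, hg⟩ := IsCyclic.exists_generator (α := Kˣ)
    have hog : orderOf g = (r + 2) * r := by
      rw [orderOf_eq_card_of_forall_mem_zpowers hg, Nat.card_eq_fintype_card,
        Fintype.card_units, hK]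
      have : (r + 1) ^ 2 = (r + 2) * r + 1 := by ring
      omega
    have hprim : IsPrimitiveRoot ((g : K) ^ r) (r + 2) := by
      have h1 : IsPrimitiveRoot (g : K) ((r + 2) * r) := by
        rw [← hog, ← orderOf_units]
        exact IsPrimitiveRoot.orderOf _
      exact h1.pow (by positivity) (mul_comm _ _)
    have hex : ∃ a : K, a ^ (r + 2) = c := by
      let u : Kˣ := Units.mk0 c h0
      have hu : u ^ r = 1 := by
        ext
        have : c ^ r * c = 1 * c := by rw [← pow_succ, hc, one_mul]
        simpa [u] using mul_right_cancel₀ h0 this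
      obtain ⟨k, hk⟩ := (mem_powers_iff_mem_zpowers).2 (hg u)
      have hk' : g ^ k = u := hk
      rw [← hk', ← pow_mul] at hu
      have hd := orderOf_dvd_of_pow_eq_one hu
      rw [hog] at hd
      obtain ⟨l, rfl⟩ := Nat.dvd_of_mul_dvd_mul_right hr hd
      refine ⟨(g : K) ^ l, ?_⟩
      have := congrArg (Units.val) hk'
      rw [← pow_mul, mul_comm l]
      simpa [u] using this
    have hcard := hprim.card_nthRoots c
    rw [if_pos hex] at hcard
    have hnd := hprim.nthRoots_nodup h0
    have hs : (Finset.univ.filter fun y : K => y ^ (r + 1 + 1) = c)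
        = (Polynomial.nthRoots (r + 2) c).toFinset := by
      ext y
      simp [Polynomial.mem_nthRoots]
    rw [Finset.sum_boole, hs, Multiset.toFinset_card_of_nodup hnd, hcard]
    push_cast
    ring

open Classical in
theorem aff_count_aux (q : ℕ) (hq : 2 ≤ q)
    (K : Type*) [Field K] [Fintype K] (hK : Fintype.card K = q ^ 2)
    (hsub : ∀ a b : K, (a - b) ^ q = a ^ q - b ^ q) (n : ℕ) :
    ∀ c : K, c ^ q = c →
    (q : ℤ) * (∑ x : Fin n → K, if ∑ i, x i ^ (q + 1) = c then (1 : ℤ) else 0) =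
      (q : ℤ) ^ (2 * n) - (-(q : ℤ)) ^ n + (q : ℤ) * (-(q : ℤ)) ^ n * if c = 0 then 1 else 0 := by
  induction n with
  | zero =>
    intro c hc
    simp [eq_comm]
  | succ n ih =>
    intro c hc
    rw [← (Fin.consEquiv (fun _ : Fin (n + 1) => K)).sum_comp, Fintype.sum_prod_type,
      Finset.mul_sum]
    have key : ∀ y : K, (q : ℤ) * (∑ x : Fin n → K,
        if ∑ i, (Fin.consEquiv (fun _ : Fin (n + 1) => K)) (y, x) i ^ (q + 1) = c
          then (1 : ℤ) else 0) = (q : ℤ) ^ (2 * n) - (-(q : ℤ)) ^ n +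
          (q : ℤ) * (-(q : ℤ)) ^ n * if y ^ (q + 1) = c then 1 else 0 := by
      intro y
      have hy : (y ^ (q + 1)) ^ q = y ^ (q + 1) := by
        have h2 : y ^ (q ^ 2) = y := by rw [← hK]; exact FiniteField.pow_card y
        calc (y ^ (q + 1)) ^ q = y ^ (q ^ 2) * y ^ q := by ring
          _ = y ^ (q + 1) := by rw [h2]; ring
      have := ih (c - y ^ (q + 1)) (by rw [hsub, hc, hy])
      simp only [sub_eq_zero, eq_comm (a := c)] at this
      rw [← this]
      congr 1
      refine Finset.sum_congr rfl fun x _ => ?_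
      simp [Fin.consEquiv, Fin.sum_univ_succ, eq_sub_iff_add_eq, add_comm]
    rw [Finset.sum_congr rfl fun y _ => key y, Finset.sum_add_distrib, ← Finset.mul_sum,
      aff_count_norm q hq K hK c hc]
    simp only [Finset.sum_const, Finset.card_univ, hK, nsmul_eq_mul]
    push_cast
    split_ifs <;> ring

/-- **Affine Fermat point count** (proof of Lemma `lm:C(Fp2)`): for `q` a power
of a prime `p` and `K` a field with `q²` elements, the number of tuples
`(x₀, …, x_{n-1}) ∈ K^n` with `x₀^{q+1} + ⋯ + x_{n-1}^{q+1} + 1 = 0` equals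
`q^{2n-1} + (-q)^{n-1}`. -/
theorem affine_fermat_point_count
    (p : ℕ) (hp : p.Prime) (q : ℕ) (hq : ∃ m : ℕ, 0 < m ∧ q = p ^ m)
    (n : ℕ) (hn : 1 ≤ n)
    (K : Type*) [Field K] [Fintype K] (hK : Fintype.card K = q ^ 2) :
    (Nat.card {x : Fin n → K // ∑ i, x i ^ (q + 1) + 1 = 0} : ℤ) =
      (q : ℤ) ^ (2 * n - 1) + (-(q : ℤ)) ^ (n - 1) := by
  classical
  obtain ⟨m, hm, hqm⟩ := hq
  have : Fact p.Prime := ⟨hp⟩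
  have hch : CharP K p := by
    apply charP_of_card_eq_prime_pow (f := m * 2)
    rw [hK, hqm, pow_mul]
  have hq2 : 2 ≤ q := by
    rw [hqm]
    exact hp.two_le.trans (Nat.le_self_pow hm.ne' p)
  have hsub : ∀ a b : K, (a - b) ^ q = a ^ q - b ^ q := by
    intro a b
    rw [hqm]
    exact sub_pow_char_pow a b m
  have hc : (-1 : K) ^ q = -1 := by
    have := hsub 0 1
    simpa [show q ≠ 0 by omega] using this
  have h := aff_count_aux q hq2 K hK hsub n (-1) hc
  obtain ⟨k, rfl⟩ : ∃ k, n = k + 1 := ⟨n - 1, by omega⟩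
  rw [Nat.card_eq_fintype_card, Fintype.card_subtype]
  rw [Finset.sum_boole] at h
  simp only [← eq_neg_iff_add_eq_zero]
  have hq0 : (q : ℤ) ≠ 0 := by
    have : q ≠ 0 := by omega
    exact_mod_cast this
  apply mul_left_cancel₀ hq0
  rw [if_neg (by simp)] at h
  refine Eq.trans ?_ (h.trans ?_)
  · simp
  · rw [show 2 * (k + 1) - 1 = 2 * k + 1 by omega, Nat.add_sub_cancel]
    ring
end

section
/- Let ℓ be a prime and let E be a quadratic field extension of ℚ_ℓ that is ramified, i.e., ℓ·O_E = 𝔪², where O_E is the integral closure of ℤ_ℓ in E and 𝔪 is the maximal ideal of O_E. Let x ↦ x̄ denote the nontrivial ℚ_ℓ-algebra automorphism of E and N(x) = x·x̄ the norm. Let n be an odd positive integer and let Φ ∈ Mat_n(O_E) be a Hermitian matrix (Φ̄ᵀ = Φ) with det Φ ≠ 0. Then {u ∈ ℤ_ℓ^× : there exists g ∈ GL_n(O_E) with ḡᵀ Φ g = u·Φ} = N(O_E^×). -/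
/-- **Similitude factors of the stabilizer of a Hermitian lattice: ramified case,
odd rank** (Lemma `mult` (1)).

Let `E/ℚ_ℓ` be a ramified quadratic field extension with ring of integers
`O_E = integralClosure ℤ_ℓ E` (ramified: `ℓ·O_E = 𝔪²` for the maximal ideal
`𝔪`), `τ` the nontrivial `ℚ_ℓ`-automorphism, and `N(x) = x·τ(x)`.  For `n` odd
and `Φ ∈ Mat_n(O_E)` Hermitian with `det Φ ≠ 0`, the set of similitude factors
`{u ∈ ℤ_ℓ^× : ∃ g ∈ GL_n(O_E), ḡᵀ Φ g = u·Φ}` equals `N(O_E^×)`. -/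
theorem sim_stabilizer_ramified_odd_rank
    (ℓ : ℕ) [hℓ : Fact ℓ.Prime]
    (E : Type*) [Field E] [Algebra ℚ_[ℓ] E]
    [Algebra ℤ_[ℓ] E] [IsScalarTower ℤ_[ℓ] ℚ_[ℓ] E]
    (hdim : Module.finrank ℚ_[ℓ] E = 2)
    (hram : ∃ 𝔪 : Ideal (integralClosure ℤ_[ℓ] E),
      𝔪.IsMaximal ∧ Ideal.span {(ℓ : integralClosure ℤ_[ℓ] E)} = 𝔪 ^ 2)
    (τ : E ≃ₐ[ℚ_[ℓ]] E) (hτ : τ ≠ AlgEquiv.refl)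
    (n : ℕ) (hodd : Odd n)
    (Φ : Matrix (Fin n) (Fin n) E)
    (hΦint : ∀ i j, Φ i j ∈ integralClosure ℤ_[ℓ] E)
    (hherm : (Φ.map τ).transpose = Φ)
    (hdet : Φ.det ≠ 0) :
    {u : ℤ_[ℓ] | IsUnit u ∧ ∃ g : Matrix (Fin n) (Fin n) E,
        (∀ i j, g i j ∈ integralClosure ℤ_[ℓ] E) ∧
        (∃ h : E, h ∈ integralClosure ℤ_[ℓ] E ∧ g.det * h = 1) ∧
        (g.map τ).transpose * Φ * g = algebraMap ℤ_[ℓ] E u • Φ} =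
      {u : ℤ_[ℓ] | ∃ a : E, a ∈ integralClosure ℤ_[ℓ] E ∧
        (∃ b : E, b ∈ integralClosure ℤ_[ℓ] E ∧ a * b = 1) ∧
        a * τ a = algebraMap ℤ_[ℓ] E u} := by
  have hτZ : ∀ z : ℤ_[ℓ], τ (algebraMap ℤ_[ℓ] E z) = algebraMap ℤ_[ℓ] E z := by
    intro z
    rw [IsScalarTower.algebraMap_apply ℤ_[ℓ] ℚ_[ℓ] E, AlgEquiv.commutes]
  have hτint : ∀ x : E, IsIntegral ℤ_[ℓ] x → IsIntegral ℤ_[ℓ] (τ x) := by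
    intro x hx
    exact hx.map (τ.toAlgHom.restrictScalars ℤ_[ℓ])
  ext u
  simp only [Set.mem_setOf_eq]
  constructor
  · rintro ⟨hu, g, hg, ⟨h, hh, hgh⟩, hgΦ⟩
    obtain ⟨v, huv⟩ := hu.exists_right_inv
    obtain ⟨k, rfl⟩ := hodd
    have hgdet : g.det ∈ integralClosure ℤ_[ℓ] E := by
      rw [Matrix.det_apply]
      exact Subalgebra.sum_mem _ fun σ _ =>
        zsmul_mem (Subalgebra.prod_mem _ fun i _ => hg _ _) _
    have key : g.det * τ g.det = algebraMap ℤ_[ℓ] E u ^ (2 * k + 1) := by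
      have h1 := congrArg Matrix.det hgΦ
      have h2 : (g.map τ).det = τ g.det := (RingHom.map_det (τ : E →+* E) g).symm
      rw [Matrix.det_mul, Matrix.det_mul, Matrix.det_transpose, Matrix.det_smul,
        Fintype.card_fin, h2] at h1
      apply mul_right_cancel₀ hdet
      rw [← h1]; ring
    have huvE : algebraMap ℤ_[ℓ] E u * algebraMap ℤ_[ℓ] E v = 1 := by
      rw [← map_mul, huv, map_one]
    refine ⟨g.det * algebraMap ℤ_[ℓ] E v ^ k,
      mul_mem hgdet (pow_mem (Subalgebra.algebraMap_mem _ _) _),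
      ⟨h * algebraMap ℤ_[ℓ] E u ^ k,
        mul_mem hh (pow_mem (Subalgebra.algebraMap_mem _ _) _), ?_⟩, ?_⟩
    · calc _ = (g.det * h) * (algebraMap ℤ_[ℓ] E u * algebraMap ℤ_[ℓ] E v) ^ k := by ring
        _ = 1 := by rw [hgh, huvE]; simp
    · rw [map_mul, map_pow, hτZ]
      calc _ = (g.det * τ g.det) * algebraMap ℤ_[ℓ] E v ^ (2 * k) := by ring
        _ = algebraMap ℤ_[ℓ] E u *
            (algebraMap ℤ_[ℓ] E u * algebraMap ℤ_[ℓ] E v) ^ (2 * k) := by rw [key]; ring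
        _ = _ := by rw [huvE]; simp
  · rintro ⟨a, ha, ⟨b, hb, hab⟩, hau⟩
    have hτab : τ a * τ b = 1 := by rw [← map_mul, hab, map_one]
    have hub : algebraMap ℤ_[ℓ] E u * (b * τ b) = 1 := by
      rw [← hau]
      calc _ = (a * b) * (τ a * τ b) := by ring
        _ = 1 := by rw [hab, hτab, one_mul]
    refine ⟨?_, a • 1, ?_, ⟨b ^ n, pow_mem hb _, ?_⟩, ?_⟩
    · have hint : IsIntegral ℤ_[ℓ] (b * τ b) := IsIntegral.mul hb (hτint b hb)
      have hbe : b * τ b = algebraMap ℚ_[ℓ] E ((u : ℚ_[ℓ])⁻¹) := by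
        rw [map_inv₀]
        rw [IsScalarTower.algebraMap_apply ℤ_[ℓ] ℚ_[ℓ] E] at hub
        exact eq_inv_of_mul_eq_one_right hub
      rw [hbe, isIntegral_algebraMap_iff (algebraMap ℚ_[ℓ] E).injective] at hint
      obtain ⟨w, hw⟩ := IsIntegrallyClosed.isIntegral_iff.mp hint
      apply IsUnit.of_mul_eq_one w
      apply FaithfulSMul.algebraMap_injective ℤ_[ℓ] ℚ_[ℓ]
      rw [map_mul, hw, map_one]
      apply mul_inv_cancel₀
      intro h0
      rw [IsScalarTower.algebraMap_apply ℤ_[ℓ] ℚ_[ℓ] E, h0] at hub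
      simp at hub
    · intro i j
      rw [Matrix.smul_apply, Matrix.one_apply]
      split_ifs
      · simpa using ha
      · simp
    · rw [Matrix.det_smul, Matrix.det_one, Fintype.card_fin, mul_one, ← mul_pow, hab, one_pow]
    · have : ((a • (1 : Matrix (Fin n) (Fin n) E)).map τ).transpose = τ a • 1 := by
        ext i j
        simp only [Matrix.transpose_apply, Matrix.map_apply, Matrix.smul_apply, Matrix.one_apply,
          smul_eq_mul, map_mul, eq_comm (a := i)]
        split_ifs <;> simp
      rw [this, ← hau]
      simp [smul_smul]
end

section
/- Let ℓ be a prime and let E be a quadratic field extension of ℚ_ℓ that is ramified, i.e., ℓ·O_E = 𝔪², where O_E is the integral closure of ℤ_ℓ in E and 𝔪 is the maximal ideal of O_E. Let x ↦ x̄ denote the nontrivial ℚ_ℓ-algebra automorphism of E. Let n be an even positive integer and let Φ ∈ GL_n(O_E) be a Hermitian matrix (Φ̄ᵀ = Φ) that is invertible over O_E. Then for every u ∈ ℤ_ℓ^× there exists g ∈ GL_n(O_E) with ḡᵀ Φ g = u·Φ; that is, {u ∈ ℤ_ℓ^× : ∃ g ∈ GL_n(O_E), ḡᵀ Φ g = u·Φ}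 = ℤ_ℓ^×. -/
section Abstract
open Matrix
variable {R : Type*} [CommRing R] [StarRing R]

/-- Congruence of Gram matrices (possibly with different index types). -/
def HCong {ι κ : Type*} [Fintype ι] [Fintype κ] [DecidableEq ι] [DecidableEq κ]
    (Φ : Matrix ι ι R) (Ψ : Matrix κ κ R) : Prop :=
  ∃ (P : Matrix κ ι R) (Q : Matrix ι κ R), P * Q = 1 ∧ Q * P = 1 ∧ Φ = Pᴴ * Ψ * P

/-- `v` is a similitude factor of `Φ`. -/
def HSim {ι : Type*} [Fintype ι] [DecidableEq ι] (v : R) (Φ : Matrix ι ι R) : Prop :=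
  ∃ (g h : Matrix ι ι R), g * h = 1 ∧ gᴴ * Φ * g = v • Φ

variable {ι κ μ : Type*} [Fintype ι] [Fintype κ] [Fintype μ]
  [DecidableEq ι] [DecidableEq κ] [DecidableEq μ]

theorem HSim.of_cong {v : R} {Φ : Matrix ι ι R} {Ψ : Matrix κ κ R}
    (h : HCong Φ Ψ) (hs : HSim v Ψ) : HSim v Φ := by
  obtain ⟨P, Q, hPQ, hQP, rfl⟩ := h
  obtain ⟨g, h, hgh, hg⟩ := hs
  refine ⟨Q * g * P, Q * h * P, ?_, ?_⟩
  · calc Q * g * P * (Q * h * P) = Q * g * (P * Q) * h * P := by simp only [Matrix.mul_assoc]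
      _ = Q * (g * h) * P := by rw [hPQ]; simp only [Matrix.mul_assoc, Matrix.one_mul]
      _ = 1 := by rw [hgh, Matrix.mul_one, hQP]
  · have e2 : Qᴴ * Pᴴ = 1 := by rw [← conjTranspose_mul, hPQ, conjTranspose_one]
    calc (Q * g * P)ᴴ * (Pᴴ * Ψ * P) * (Q * g * P)
        = Pᴴ * gᴴ * (Qᴴ * Pᴴ) * Ψ * (P * Q) * g * P := by
          simp only [conjTranspose_mul, Matrix.mul_assoc]
      _ = Pᴴ * (gᴴ * Ψ * g) * P := by
          rw [e2, hPQ]; simp only [Matrix.mul_assoc, Matrix.one_mul]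
      _ = v • (Pᴴ * Ψ * P) := by rw [hg]; simp

theorem HCong.trans {Φ : Matrix ι ι R} {Ψ : Matrix κ κ R} {X : Matrix μ μ R}
    (h : HCong Φ Ψ) (h' : HCong Ψ X) : HCong Φ X := by
  obtain ⟨P, Q, hPQ, hQP, rfl⟩ := h
  obtain ⟨P', Q', hPQ', hQP', rfl⟩ := h'
  refine ⟨P' * P, Q * Q', ?_, ?_, ?_⟩
  · calc P' * P * (Q * Q') = P' * (P * Q) * Q' := by simp only [Matrix.mul_assoc]
      _ = 1 := by rw [hPQ, Matrix.mul_one, hPQ']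
  · calc Q * Q' * (P' * P) = Q * (Q' * P') * P := by simp only [Matrix.mul_assoc]
      _ = 1 := by rw [hQP', Matrix.mul_one, hQP]
  · simp only [conjTranspose_mul, Matrix.mul_assoc]

theorem HCong.blocks (A : Matrix μ μ R) {Φ : Matrix ι ι R} {Ψ : Matrix κ κ R}
    (h : HCong Φ Ψ) : HCong (fromBlocks A 0 0 Φ) (fromBlocks A 0 0 Ψ) := by
  obtain ⟨P, Q, hPQ, hQP, rfl⟩ := h
  refine ⟨fromBlocks 1 0 0 P, fromBlocks 1 0 0 Q, ?_, ?_, ?_⟩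
  · simp [fromBlocks_multiply, hPQ]
  · simp [fromBlocks_multiply, hQP]
  · simp [fromBlocks_multiply, fromBlocks_conjTranspose]

theorem HCong.reindex (Φ : Matrix ι ι R) (e : κ ≃ ι) : HCong Φ (Φ.submatrix e e) := by
  refine ⟨(1 : Matrix ι ι R).submatrix e id, (1 : Matrix ι ι R).submatrix id e, ?_, ?_, ?_⟩
  · have := submatrix_mul_equiv (1 : Matrix ι ι R) (1 : Matrix ι ι R) e (Equiv.refl ι) e
    simpa using this
  · rw [submatrix_mul_equiv]; simp
  · rw [conjTranspose_submatrix, submatrix_mul_equiv, submatrix_mul_equiv]; simp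

theorem HCong.assoc (A : Matrix μ μ R) (Φ : Matrix ι ι R) (Ψ : Matrix κ κ R) :
    HCong (fromBlocks A 0 0 (fromBlocks Φ 0 0 Ψ)) (fromBlocks (fromBlocks A 0 0 Φ) 0 0 Ψ) := by
  have := HCong.reindex (fromBlocks A 0 0 (fromBlocks Φ 0 0 Ψ)) (Equiv.sumAssoc μ ι κ)
  convert this using 1
  ext i j
  rcases i with (i | i) | i <;> rcases j with (j | j) | j <;> simp

theorem HCong.leftComm (A : Matrix μ μ R) (Φ : Matrix ι ι R) (Ψ : Matrix κ κ R) :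
    HCong (fromBlocks A 0 0 (fromBlocks Φ 0 0 Ψ)) (fromBlocks Φ 0 0 (fromBlocks A 0 0 Ψ)) := by
  have := HCong.reindex (fromBlocks A 0 0 (fromBlocks Φ 0 0 Ψ))
    ((Equiv.sumAssoc ι μ κ).symm.trans
      ((Equiv.sumCongr (Equiv.sumComm ι μ) (Equiv.refl κ)).trans (Equiv.sumAssoc μ ι κ)))
  convert this using 1
  ext i j
  rcases i with i | i | i <;> rcases j with j | j | j <;> simp

theorem HSim.blocks {v : R} {Φ : Matrix ι ι R} {Ψ : Matrix κ κ R}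
    (h : HSim v Φ) (h' : HSim v Ψ) : HSim v (fromBlocks Φ 0 0 Ψ) := by
  obtain ⟨g, k, hgk, hg⟩ := h
  obtain ⟨g', k', hgk', hg'⟩ := h'
  refine ⟨fromBlocks g 0 0 g', fromBlocks k 0 0 k', ?_, ?_⟩
  · simp [fromBlocks_multiply, hgk, hgk']
  · simp [fromBlocks_multiply, fromBlocks_conjTranspose, fromBlocks_smul, hg, hg']

/-- Splitting off a unimodular block. -/
theorem exists_split (Φ : Matrix ι ι R) (hΦ : Φᴴ = Φ) (hu : IsUnit Φ)
    (f : κ → ι) (hf : Function.Injective f) (hA : IsUnit (Φ.submatrix f f)) :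
    ∃ (p : Set ι) (_ : DecidablePred (· ∈ p)) (Φ' : Matrix p p R), Φ'ᴴ = Φ' ∧ IsUnit Φ' ∧
      Fintype.card κ + Fintype.card p = Fintype.card ι ∧
      HCong Φ (fromBlocks (Φ.submatrix f f) 0 0 Φ') := by
  classical
  let p : Set ι := (Set.range f)ᶜ
  let e : κ ⊕ p ≃ ι :=
    (Equiv.sumCongr (Equiv.ofInjective f hf) (Equiv.refl _)).trans (Equiv.Set.sumCompl (Set.range f))
  have h1 := HCong.reindex Φ e
  set Ψ := Φ.submatrix e e with hΨ
  have hΨh : Ψᴴ = Ψ := by rw [hΨ, conjTranspose_submatrix, hΦ]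
  have hΨu : IsUnit Ψ := by
    rw [hΨ, Matrix.isUnit_iff_isUnit_det, Matrix.det_submatrix_equiv_self,
      ← Matrix.isUnit_iff_isUnit_det]; exact hu
  have hA' : Ψ.toBlocks₁₁ = Φ.submatrix f f := by
    have he : ∀ i, e (Sum.inl i) = f i := fun i => rfl
    ext i j
    change Φ (e (Sum.inl i)) (e (Sum.inl j)) = Φ (f i) (f j)
    rw [he, he]
  set A := Φ.submatrix f f with hAdef
  set B := Ψ.toBlocks₁₂
  set C := Ψ.toBlocks₂₁
  set D := Ψ.toBlocks₂₂
  have hblk : Ψ = fromBlocks A B C D := by rw [← hA']; exact (fromBlocks_toBlocks Ψ).symm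
  have hh := hΨh
  rw [hblk, fromBlocks_conjTranspose, fromBlocks_inj] at hh
  obtain ⟨hAh, hCB, hBC, hDh⟩ := hh
  obtain ⟨iA⟩ := hA.nonempty_invertible
  have hiA : (⅟A)ᴴ = ⅟A := by
    apply (invOf_eq_left_inv _).symm
    nth_rewrite 2 [← hAh]
    rw [← conjTranspose_mul, mul_invOf_self, conjTranspose_one]
  have hldu := fromBlocks_eq_of_invertible₁₁ A B C D
  let P : Matrix (κ ⊕ p) (κ ⊕ p) R := fromBlocks 1 (⅟A * B) 0 1
  let Q : Matrix (κ ⊕ p) (κ ⊕ p) R := fromBlocks 1 (-(⅟A * B)) 0 1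
  have hPQ : P * Q = 1 := by simp [P, Q, fromBlocks_multiply]
  have hQP : Q * P = 1 := by simp [P, Q, fromBlocks_multiply]
  have hPh : Pᴴ = fromBlocks 1 0 (C * ⅟A) 1 := by
    simp only [P, fromBlocks_conjTranspose, conjTranspose_mul, hiA, hBC, conjTranspose_one,
      conjTranspose_zero]
  have heq : Ψ = Pᴴ * fromBlocks A 0 0 (D - C * ⅟A * B) * P := by
    rw [hPh, hblk]; exact hldu
  refine ⟨p, inferInstance, D - C * ⅟A * B, ?_, ?_, ?_, ?_⟩
  · simp only [conjTranspose_sub, conjTranspose_mul, hiA, hBC, hCB, hDh, Matrix.mul_assoc]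
  · have : IsUnit (fromBlocks A B C D).det := by
      rw [← hblk, ← Matrix.isUnit_iff_isUnit_det]; exact hΨu
    rw [det_fromBlocks₁₁] at this
    exact (Matrix.isUnit_iff_isUnit_det _).2 (isUnit_of_mul_isUnit_right this)
  · rw [← Fintype.card_sum]; exact Fintype.card_congr e
  · exact h1.trans ⟨P, Q, hPQ, hQP, heq⟩

end Abstract

section Main
open Matrix
variable {A R : Type*} [CommRing A] [CommRing R] [StarRing R] [Algebra A R]

theorem sim_diag (hA : ∀ a : A, star (algebraMap A R a) = algebraMap A R a)
    (a b u : A) (hu : IsUnit u)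
    (x y : R) (hxy : star x * x + algebraMap A R (a * b) * (star y * y) = algebraMap A R u) :
    HSim (algebraMap A R u) (fromBlocks (of fun _ _ : Fin 1 => algebraMap A R a) 0 0
      (of fun _ _ : Fin 1 => algebraMap A R b)) := by
  obtain ⟨v, hv⟩ := hu.exists_right_inv
  have hv' : algebraMap A R u * algebraMap A R v = 1 := by rw [← map_mul, hv, map_one]
  rw [map_mul] at hxy
  have ha := hA a
  have hb := hA b
  generalize algebraMap A R u = u at *
  generalize algebraMap A R v = v at *
  generalize algebraMap A R a = a at *
  generalize algebraMap A R b = b at *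
  refine ⟨fromBlocks (of fun _ _ => x) (of fun _ _ => -b * star y) (of fun _ _ => a * y)
    (of fun _ _ => star x), v • fromBlocks (of fun _ _ => star x) (of fun _ _ => b * star y)
      (of fun _ _ => -a * y) (of fun _ _ => x), ?_, ?_⟩
  · rw [Matrix.mul_smul, fromBlocks_multiply, fromBlocks_smul, ← fromBlocks_one, fromBlocks_inj]
    refine ⟨?_, ?_, ?_, ?_⟩ <;> ext i j <;>
      obtain rfl := Subsingleton.elim i j <;>
      simp [Matrix.mul_apply] <;> grind
  · rw [fromBlocks_conjTranspose, fromBlocks_multiply, fromBlocks_multiply, fromBlocks_smul,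
      fromBlocks_inj]
    refine ⟨?_, ?_, ?_, ?_⟩ <;> ext i j <;>
      simp [Matrix.mul_apply, ha, hb] <;> grind

theorem sim_plane (hA : ∀ a : A, star (algebraMap A R a) = algebraMap A R a)
    (a c n s t u : A) (hu : IsUnit u) (b b' : R) (hb : b * b' = 1)
    (hn : algebraMap A R n = star b' * b')
    (hst : s * s + s * t + a * (c * n) * (t * t) = u) :
    HSim (algebraMap A R u) !![algebraMap A R (2 * a), b; star b, algebraMap A R (2 * c)] := by
  obtain ⟨v, hv⟩ := hu.exists_right_inv
  have hv' : algebraMap A R u * algebraMap A R v = 1 := by rw [← map_mul, hv, map_one]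
  have hb2 : star b * star b' = 1 := by rw [← star_mul', hb, star_one]
  have hst' := congrArg (algebraMap A R) hst
  simp only [map_mul, map_add, map_ofNat] at hst' ⊢
  have ha := hA a
  have hc := hA c
  have hn' := hA n
  have hs := hA s
  have ht := hA t
  generalize algebraMap A R u = u at *
  generalize algebraMap A R v = v at *
  generalize algebraMap A R a = a at *
  generalize algebraMap A R c = c at *
  generalize algebraMap A R n = n at *
  generalize algebraMap A R s = s at *
  generalize algebraMap A R t = t at *
  apply HSim.of_cong (Ψ := !![2 * a, 1; 1, 2 * (c * n)])
  · refine ⟨!![1, 0; 0, b], !![1, 0; 0, b'], ?_, ?_, ?_⟩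
    · ext i j; fin_cases i <;> fin_cases j <;> simp [hb]
    · ext i j; fin_cases i <;> fin_cases j <;> simp [mul_comm b', hb]
    · ext i j; fin_cases i <;> fin_cases j <;> simp [Matrix.mul_apply] <;> grind
  · refine ⟨!![s, -(c * n) * t; a * t, s + t], v • !![s + t, (c * n) * t; -a * t, s], ?_, ?_⟩
    · ext i j; fin_cases i <;> fin_cases j <;> simp [Matrix.mul_apply] <;> grind
    · ext i j; fin_cases i <;> fin_cases j <;>
        simp [Matrix.mul_apply, Fin.sum_univ_two, ha, hc, hn', hs, ht] <;> grind

theorem sim_main [IsLocalRing R]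
    (hinj : Function.Injective (algebraMap A R))
    (hA : ∀ a : A, star (algebraMap A R a) = algebraMap A R a)
    (hfix : ∀ r : R, star r = r → ∃ a : A, algebraMap A R a = r)
    (h2 : ∀ a : A, ¬ IsUnit a → ∃ a', a = 2 * a')
    (u : A) (hu : IsUnit u)
    (hdiag : ∀ c : A, IsUnit c → ∃ x y : R,
      star x * x + algebraMap A R c * (star y * y) = algebraMap A R u)
    (hplane : ∀ a c n : A, ¬ IsUnit (2 * a) → ¬ IsUnit (2 * c) → ∃ s t : A,
      s * s + s * t + a * (c * n) * (t * t) = u) (m : ℕ) :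
    ∀ (ι : Type) [Fintype ι] [DecidableEq ι] (Φ : Matrix ι ι R), Fintype.card ι = m →
      Φᴴ = Φ → IsUnit Φ →
      (Even m → HSim (algebraMap A R u) Φ) ∧
      (¬ Even m → ∀ a : A, IsUnit a → HSim (algebraMap A R u)
        (fromBlocks (of fun _ _ : Fin 1 => algebraMap A R a) 0 0 Φ)) := by
  have hunitA : ∀ a : A, IsUnit (algebraMap A R a) → IsUnit a := by
    intro a h
    obtain ⟨r, hr⟩ := h.exists_right_inv
    have hr2 : algebraMap A R a * star r = 1 := by
      have := congrArg star hr
      rwa [star_mul', hA, star_one] at this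
    have : star r = r := by
      calc star r = (algebraMap A R a * r) * star r := by rw [hr, one_mul]
        _ = r := by rw [mul_right_comm, hr2, one_mul]
    obtain ⟨b, rfl⟩ := hfix r this
    exact IsUnit.of_mul_eq_one b (hinj (by rw [map_mul, hr, map_one]))
  induction m using Nat.strong_induction_on with
  | _ m ih =>
  intro ι _ _ Φ hcard hΦ hΦu
  have hherm : ∀ i j, star (Φ i j) = Φ j i := fun i j => by
    conv_rhs => rw [← hΦ]
    rfl
  by_cases hd : ∃ i, IsUnit (Φ i i)
  · obtain ⟨i, hi⟩ := hd
    obtain ⟨b, hb⟩ := hfix (Φ i i) (hherm i i)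
    have hbu : IsUnit b := hunitA b (hb ▸ hi)
    have hsub : Φ.submatrix (fun _ : Fin 1 => i) (fun _ => i)
      = of fun _ _ : Fin 1 => algebraMap A R b := by ext; simp [hb]
    obtain ⟨p, _, Φ', hΦ', hΦ'u, hc, hcong⟩ := exists_split Φ hΦ hΦu (fun _ : Fin 1 => i)
      (fun _ _ _ => Subsingleton.elim _ _) (by
        rw [hsub, Matrix.isUnit_iff_isUnit_det]; simpa [hb] using hi)
    rw [hsub] at hcong
    rw [Fintype.card_fin, hcard] at hc
    have := ih (Fintype.card p) (by omega) p Φ' (by convert rfl) hΦ' hΦ'u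
    constructor
    · intro hev
      refine HSim.of_cong hcong ?_
      convert this.2 (by grind) b hbu
    · intro hev a ha
      refine HSim.of_cong ((hcong.blocks _).trans (HCong.assoc _ _ _)) ?_
      obtain ⟨x, y, hxy⟩ := hdiag (a * b) (ha.mul hbu)
      refine HSim.blocks (sim_diag hA a b u hu x y hxy) ?_
      convert this.1 (by grind)
  · push Not at hd
    rcases Nat.eq_zero_or_pos m with h0 | hpos
    · have : IsEmpty ι := Fintype.card_eq_zero_iff.1 (hcard.trans h0)
      refine ⟨fun _ => ⟨1, 1, by simp, Subsingleton.elim _ _⟩, fun h => absurd (by simp [h0]) h⟩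
    obtain ⟨i⟩ : Nonempty ι := Fintype.card_pos_iff.1 (hcard ▸ hpos)
    obtain ⟨j, hj⟩ : ∃ j, IsUnit (Φ i j) := by
      obtain ⟨Ψ, hΨ⟩ := hΦu.exists_right_inv
      by_contra! hcon
      have h1 := congrFun (congrFun hΨ i) i
      rw [Matrix.mul_apply, one_apply_eq] at h1
      have : (1 : R) ∈ IsLocalRing.maximalIdeal R := by
        rw [← h1]
        exact Ideal.sum_mem _ fun k _ => Ideal.mul_mem_right _ _
          ((IsLocalRing.mem_maximalIdeal _).2 (hcon k))
      exact (IsLocalRing.mem_maximalIdeal _).1 this isUnit_one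
    have hij : i ≠ j := by rintro rfl; exact hd _ hj
    obtain ⟨a, ha⟩ := hfix (Φ i i) (hherm i i)
    obtain ⟨c, hc⟩ := hfix (Φ j j) (hherm j j)
    have hau : ¬ IsUnit a := fun h => hd i (ha ▸ h.map _)
    have hcu : ¬ IsUnit c := fun h => hd j (hc ▸ h.map _)
    obtain ⟨a, rfl⟩ := h2 a hau
    obtain ⟨c, rfl⟩ := h2 c hcu
    obtain ⟨b', hb'⟩ := hj.exists_right_inv
    obtain ⟨n, hn⟩ := hfix (star b' * b') (by simp [mul_comm])
    obtain ⟨s, t, hst⟩ := hplane a c n hau hcu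
    have hsim := sim_plane hA a c n s t u hu (Φ i j) b' hb' hn hst
    have hsub : Φ.submatrix ![i, j] ![i, j] =
        !![algebraMap A R (2 * a), Φ i j; star (Φ i j), algebraMap A R (2 * c)] := by
      ext k l; fin_cases k <;> fin_cases l <;> simp [ha, hc, hherm]
    obtain ⟨p, _, Φ', hΦ', hΦ'u, hc', hcong⟩ := exists_split Φ hΦ hΦu ![i, j]
      (by intro k l; fin_cases k <;> fin_cases l <;> simp [hij, hij.symm]) (by
        rw [hsub, Matrix.isUnit_iff_isUnit_det, det_fin_two_of]
        by_contra hcon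
        have h1 : algebraMap A R (2 * a) * algebraMap A R (2 * c) ∈ IsLocalRing.maximalIdeal R :=
          Ideal.mul_mem_right _ _ ((IsLocalRing.mem_maximalIdeal _).2 (ha ▸ hd i))
        have h3 := Ideal.sub_mem _ h1 ((IsLocalRing.mem_maximalIdeal _).2 hcon)
        rw [sub_sub_cancel] at h3
        exact (IsLocalRing.mem_maximalIdeal _).1 h3 (hj.mul hj.star))
    rw [hsub] at hcong
    rw [Fintype.card_fin, hcard] at hc'
    have := ih (Fintype.card p) (by omega) p Φ' (by convert rfl) hΦ' hΦ'u
    have hev2 : Even m ↔ Even (Fintype.card p) := by grind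
    constructor
    · intro hev
      refine HSim.of_cong hcong (HSim.blocks hsim ?_)
      convert this.1 (hev2.1 hev)
    · intro hev a' ha'
      refine HSim.of_cong ((hcong.blocks _).trans (HCong.leftComm _ _ _)) (HSim.blocks hsim ?_)
      convert this.2 (fun h => hev (hev2.2 h)) a' ha'

end Main

section Padic
variable {ℓ : ℕ} [hℓ : Fact ℓ.Prime]

theorem padic_quad (a b c z : ℤ_[ℓ]) (h : ‖a * z ^ 2 + b * z + c‖ < ‖2 * a * z + b‖ ^ 2) :
    ∃ x : ℤ_[ℓ], a * x ^ 2 + b * x + c = 0 := by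
  have hder : (Polynomial.C a * Polynomial.X ^ 2 + Polynomial.C b * Polynomial.X
      + Polynomial.C c).derivative = Polynomial.C (2 * a) * Polynomial.X + Polynomial.C b := by
    simp [Polynomial.derivative_pow]; ring
  obtain ⟨x, hx, -⟩ := hensels_lemma (p := ℓ) (R := ℤ_[ℓ])
    (F := Polynomial.C a * Polynomial.X ^ 2 + Polynomial.C b * Polynomial.X + Polynomial.C c)
    (a := z) (by
      rw [hder]
      simpa using h)
  exact ⟨x, by simpa using hx⟩

theorem padic_two_unit (h2 : ℓ ≠ 2) : IsUnit (2 : ℤ_[ℓ]) := by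
  have : ((2 : ℕ) : ℤ_[ℓ]) = 2 := by norm_num
  rw [← this, PadicInt.isUnit_iff, PadicInt.norm_natCast_eq_one_iff]
  exact (Nat.coprime_primes hℓ.out Nat.prime_two).2 h2

theorem padic_half (a : ℤ_[ℓ]) (ha : ¬ IsUnit a) : ∃ a', a = 2 * a' := by
  by_cases h2 : ℓ = 2
  · subst h2
    have := (PadicInt.mem_nonunits.1 ha)
    rw [PadicInt.norm_lt_one_iff_dvd] at this
    exact_mod_cast this
  · exact (padic_two_unit h2).dvd

theorem zmod2_eq_one : ∀ y : ZMod 2, y ≠ 0 → y = 1 := by decide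

theorem padic_odd_sub (h2 : ℓ = 2) (a b : ℤ_[ℓ]) (ha : IsUnit a) (hb : IsUnit b) :
    ¬ IsUnit (a - b) := by
  subst h2
  have key : ∀ x : ℤ_[2], IsUnit x → PadicInt.toZMod x = 1 := by
    intro x hx
    have := hx.map (PadicInt.toZMod (p := 2))
    revert this
    generalize PadicInt.toZMod x = y
    revert y
    intro y hy
    exact zmod2_eq_one y hy.ne_zero
  intro h
  have h1 := key _ h
  rw [map_sub, key a ha, key b hb] at h1
  simp at h1

theorem padic_plane (u : ℤ_[ℓ]) (hu : IsUnit u) (a c n : ℤ_[ℓ]) (ha : ¬ IsUnit (2 * a))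
    (_hc : ¬ IsUnit (2 * c)) : ∃ s t : ℤ_[ℓ], s * s + s * t + a * (c * n) * (t * t) = u := by
  by_cases hk : IsUnit (a * (c * n))
  · have hl : ℓ = 2 := by
      by_contra h
      exact ha ((padic_two_unit h).mul (isUnit_of_mul_isUnit_left hk))
    obtain ⟨s, hs⟩ := padic_quad 1 1 (a * (c * n) - u) 0 (by
      simpa using PadicInt.mem_nonunits.1 (padic_odd_sub hl _ _ hk hu))
    exact ⟨s, 1, by linear_combination hs⟩
  · have hk' := PadicInt.mem_nonunits.1 hk
    set k := a * (c * n)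
    obtain ⟨t, ht⟩ := padic_quad k 1 (1 - u) (u - 1) (by
      have h1 : ‖2 * k * (u - 1) + 1‖ = 1 := by
        have : IsUnit (2 * k * (u - 1) + 1) := by
          by_contra hcon
          have h3 : 2 * k * (u - 1) ∈ IsLocalRing.maximalIdeal ℤ_[ℓ] :=
            Ideal.mul_mem_right _ _ (Ideal.mul_mem_left _ _ ((IsLocalRing.mem_maximalIdeal _).2 hk))
          have := Ideal.sub_mem _ ((IsLocalRing.mem_maximalIdeal _).2 hcon) h3
          rw [add_sub_cancel_left] at this
          exact (IsLocalRing.mem_maximalIdeal _).1 this isUnit_one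
        exact PadicInt.isUnit_iff.1 this
      rw [h1]
      have : k * (u - 1) ^ 2 + 1 * (u - 1) + (1 - u) = k * (u - 1) ^ 2 := by ring
      rw [this, norm_mul, one_pow]
      exact mul_lt_one_of_nonneg_of_lt_one_left (norm_nonneg _) hk' (PadicInt.norm_le_one _))
    exact ⟨1, t, by linear_combination ht⟩

theorem padic_toZMod_zero (x : ℤ_[ℓ]) (h : PadicInt.toZMod x = 0) : ‖x‖ < 1 := by
  apply PadicInt.mem_nonunits.1
  rw [← IsLocalRing.mem_maximalIdeal, ← PadicInt.ker_toZMod]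
  exact h

theorem padic_unit_of_toZMod (x : ℤ_[ℓ]) (h : PadicInt.toZMod x ≠ 0) : IsUnit x := by
  by_contra hx
  rw [← mem_nonunits_iff, ← IsLocalRing.mem_maximalIdeal, ← PadicInt.ker_toZMod] at hx
  exact h hx

theorem padic_odd_diag (h2 : ℓ ≠ 2) (u c : ℤ_[ℓ]) (hu : IsUnit u) (hc : IsUnit c) :
    ∃ x y : ℤ_[ℓ], x * x + c * (y * y) = u := by
  have hlift : ∀ a : ℤ_[ℓ], IsUnit a → ∀ z v : ℤ_[ℓ], IsUnit z →
      PadicInt.toZMod (a * z ^ 2 - v) = 0 → ∃ x, a * x ^ 2 = v := by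
    intro a ha z v hz h
    obtain ⟨x, hx⟩ := padic_quad a 0 (-v) z (by
      have : ‖2 * a * z + 0‖ = 1 := by
        rw [add_zero]
        exact PadicInt.isUnit_iff.1 (((padic_two_unit h2).mul ha).mul hz)
      rw [this]
      have := padic_toZMod_zero _ h
      simpa [sub_eq_add_neg] using this)
    exact ⟨x, by linear_combination hx⟩
  set π := PadicInt.toZMod (p := ℓ)
  have hc0 : π c ≠ 0 := (hc.map π).ne_zero
  have hu0 : π u ≠ 0 := (hu.map π).ne_zero
  obtain ⟨x, y, hxy⟩ := FiniteField.exists_root_sum_quadratic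
    (R := ZMod ℓ) (f := Polynomial.X ^ 2)
    (g := Polynomial.C (π c) * Polynomial.X ^ 2 + Polynomial.C 0 * Polynomial.X
      + Polynomial.C (-π u)) (by simp) (by
      exact Polynomial.degree_quadratic hc0) (by
      rw [ZMod.card]; exact hℓ.out.mod_two_eq_one_iff_ne_two.2 h2)
  obtain ⟨x, rfl⟩ := ZMod.ringHom_surjective π x
  obtain ⟨y, rfl⟩ := ZMod.ringHom_surjective π y
  simp at hxy
  by_cases hx : π x = 0
  · have hy : π y ≠ 0 := by
      intro hy
      rw [hx, hy] at hxy
      exact hu0 (by simpa using hxy)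
    obtain ⟨z, hz⟩ := hlift c hc y (u - x * x) (padic_unit_of_toZMod _ hy) (by
      simp only [map_sub, map_mul, map_pow]
      linear_combination hxy)
    exact ⟨x, z, by linear_combination hz⟩
  · obtain ⟨z, hz⟩ := hlift 1 isUnit_one x (u - c * (y * y)) (padic_unit_of_toZMod _ hx) (by
      simp only [map_sub, map_mul, map_pow, map_one]
      linear_combination hxy)
    exact ⟨z, y, by linear_combination hz⟩

theorem padic_sq_of_one_mod_eight (v : ℤ_[2]) (hv : PadicInt.toZModPow 3 v = 1) :
    ∃ x, x ^ 2 = v := by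
  have h : 1 - v ∈ RingHom.ker (PadicInt.toZModPow (p := 2) 3) := by
    rw [RingHom.mem_ker, map_sub, map_one, hv, sub_self]
  rw [PadicInt.ker_toZModPow, ← PadicInt.norm_le_pow_iff_mem_span_pow] at h
  obtain ⟨x, hx⟩ := padic_quad 1 0 (-v) 1 (by
    have h2 : ‖(2 : ℤ_[2])‖ = 1 / 2 := by
      have := PadicInt.norm_p (p := 2)
      norm_num at this ⊢; exact this
    have : (1 : ℤ_[2]) * 1 ^ 2 + 0 * 1 + -v = 1 - v := by ring
    rw [this, mul_one, mul_one, add_zero, h2]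
    refine lt_of_le_of_lt h ?_
    norm_num)
  exact ⟨x, by linear_combination hx⟩

theorem zmod8_rep : ∀ d c u : ZMod 8, (d = 2 ∨ d = 6 ∨ d = 3 ∨ d = 7) → IsUnit c → IsUnit u →
    ∃ x y z : ZMod 8, u + d * (x * x) - c * (y * y) + c * d * (z * z) = 1 := by
  decide

theorem padic_two_diag (d c u : ℤ_[2]) (hc : IsUnit c) (hu : IsUnit u)
    (hd : PadicInt.toZModPow 3 d = 2 ∨ PadicInt.toZModPow 3 d = 6 ∨
      PadicInt.toZModPow 3 d = 3 ∨ PadicInt.toZModPow 3 d = 7) :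
    ∃ x y z w : ℤ_[2], (x * x - d * (y * y)) + c * (z * z - d * (w * w)) = u := by
  obtain ⟨y, z, w, h⟩ := zmod8_rep _ _ _ hd (hc.map (PadicInt.toZModPow (p := 2) 3)) (hu.map (PadicInt.toZModPow (p := 2) 3))
  obtain ⟨y, rfl⟩ := ZMod.ringHom_surjective (PadicInt.toZModPow (p := 2) 3) y
  obtain ⟨z, rfl⟩ := ZMod.ringHom_surjective (PadicInt.toZModPow (p := 2) 3) z
  obtain ⟨w, rfl⟩ := ZMod.ringHom_surjective (PadicInt.toZModPow (p := 2) 3) w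
  obtain ⟨x, hx⟩ := padic_sq_of_one_mod_eight
    (u + d * (y * y) - c * (z * z) + c * d * (w * w)) (by
      simp only [map_add, map_sub, map_mul]; exact h)
  exact ⟨x, y, z, w, by linear_combination hx⟩

end Padic

section Ram
variable {ℓ : ℕ} [hℓ : Fact ℓ.Prime]

theorem ram_not_unit {R : Type*} [CommRing R] [StarRing R] [Algebra ℤ_[ℓ] R] [IsLocalRing R]
    (hinj : Function.Injective (algebraMap ℤ_[ℓ] R))
    (hA : ∀ a : ℤ_[ℓ], star (algebraMap ℤ_[ℓ] R a) = algebraMap ℤ_[ℓ] R a)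
    (hfix : ∀ r : R, star r = r → ∃ a : ℤ_[ℓ], algebraMap ℤ_[ℓ] R a = r)
    (hram : Ideal.span {(ℓ : R)} = IsLocalRing.maximalIdeal R ^ 2) (ω : R) :
    ¬ IsUnit (ω - star ω) := by
  intro hw
  obtain ⟨w', hw'⟩ := hw.exists_right_inv
  have hsw' : star w' = -w' := by
    have h1 := congrArg star hw'
    rw [star_mul', star_sub, star_star, star_one] at h1
    linear_combination (-w') * h1 - (star w') * hw'
  have hmem : ∀ a : ℤ_[ℓ], algebraMap ℤ_[ℓ] R a ∈ IsLocalRing.maximalIdeal R →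
      algebraMap ℤ_[ℓ] R a ∈ Ideal.span {(ℓ : R)} := by
    intro a ha
    have : ¬ IsUnit a := fun h => (IsLocalRing.mem_maximalIdeal _).1 ha (h.map _)
    have h2 := PadicInt.mem_nonunits.1 this
    rw [PadicInt.norm_lt_one_iff_dvd] at h2
    obtain ⟨b, rfl⟩ := h2
    rw [map_mul, map_natCast]
    exact Ideal.mul_mem_right _ _ (Ideal.mem_span_singleton_self _)
  have hle : IsLocalRing.maximalIdeal R ≤ Ideal.span {(ℓ : R)} := by
    intro π hπ
    have hπ' : star π ∈ IsLocalRing.maximalIdeal R := by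
      rw [IsLocalRing.mem_maximalIdeal] at hπ ⊢
      intro h
      exact hπ (isUnit_star.1 h)
    have hy : (π - star π) * w' ∈ IsLocalRing.maximalIdeal R :=
      Ideal.mul_mem_right _ _ (Ideal.sub_mem _ hπ hπ')
    obtain ⟨y, hy1⟩ := hfix ((π - star π) * w') (by
      rw [star_mul', star_sub, star_star, hsw']; ring)
    rw [← hy1] at hy
    have hx : π - algebraMap ℤ_[ℓ] R y * ω ∈ IsLocalRing.maximalIdeal R :=
      Ideal.sub_mem _ hπ (Ideal.mul_mem_right _ _ hy)
    obtain ⟨x, hx1⟩ := hfix (π - algebraMap ℤ_[ℓ] R y * ω) (by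
      rw [star_sub, star_mul', hA, hy1]
      linear_combination (π - star π) * hw')
    rw [← hx1] at hx
    have := Ideal.add_mem _ (hmem _ hx) (Ideal.mul_mem_right ω _ (hmem _ hy))
    rwa [hx1, sub_add_cancel] at this
  have hlm : (ℓ : R) ∈ IsLocalRing.maximalIdeal R := by
    have : (ℓ : R) ∈ IsLocalRing.maximalIdeal R ^ 2 := hram ▸ Ideal.mem_span_singleton_self _
    exact Ideal.pow_le_self two_ne_zero this
  have h1 : (ℓ : R) ∈ Ideal.span {(ℓ : R)} ^ 2 := by
    have : (ℓ : R) ∈ IsLocalRing.maximalIdeal R ^ 2 := hram ▸ Ideal.mem_span_singleton_self _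
    exact Ideal.pow_right_mono hle 2 this
  rw [Ideal.span_singleton_pow, Ideal.mem_span_singleton] at h1
  obtain ⟨t, ht⟩ := h1
  have hu : IsUnit (1 - ℓ * t) := by
    by_contra hcon
    have := Ideal.add_mem _ ((IsLocalRing.mem_maximalIdeal _).2 hcon)
      (Ideal.mul_mem_right t _ hlm)
    rw [sub_add_cancel] at this
    exact (IsLocalRing.mem_maximalIdeal _).1 this isUnit_one
  have h0 : (ℓ : R) = 0 := by
    have : (ℓ : R) * (1 - ℓ * t) = 0 := by linear_combination ht
    exact (hu.mul_left_eq_zero).1 this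
  rw [← map_natCast (algebraMap ℤ_[ℓ] R), ← map_zero (algebraMap ℤ_[ℓ] R)] at h0
  exact hℓ.out.ne_zero (by exact_mod_cast hinj h0)

theorem zmod8_cases : ∀ d : ZMod 8, d ≠ 0 → d ≠ 4 → d ≠ 1 → d ≠ 5 →
    (d = 2 ∨ d = 6 ∨ d = 3 ∨ d = 7) := by decide

/-- An odd-valuation-normalised square generator: an element `w` of `E` with `τ w = -w` and
`w ^ 2 = d` where `d` is in `ℤ_[ℓ]` and not divisible by `ℓ ^ 2`. -/
theorem exists_normalized {E : Type*} [Field E] [Algebra ℚ_[ℓ] E]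
    [Algebra ℤ_[ℓ] E] [IsScalarTower ℤ_[ℓ] ℚ_[ℓ] E]
    (τ : E ≃ₐ[ℚ_[ℓ]] E) (hτ : τ ≠ AlgEquiv.refl) (hττ : ∀ x, τ (τ x) = x)
    (hfix : ∀ x, τ x = x → ∃ q : ℚ_[ℓ], algebraMap ℚ_[ℓ] E q = x) (h2 : (2 : E) ≠ 0) :
    ∃ (w : E) (d : ℤ_[ℓ]), τ w = -w ∧ w ^ 2 = algebraMap ℤ_[ℓ] E d ∧ ¬ ((ℓ : ℤ_[ℓ]) ^ 2 ∣ d) := by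
  obtain ⟨z, hz⟩ : ∃ z, τ z ≠ z := by
    by_contra! h
    exact hτ (AlgEquiv.ext h)
  have hw0 : z - τ z ≠ 0 := sub_ne_zero.2 hz.symm
  have hw1 : τ (z - τ z) = -(z - τ z) := by rw [map_sub, hττ]; ring
  generalize z - τ z = w at hw0 hw1
  obtain ⟨q, hq⟩ := hfix (w ^ 2) (by rw [map_pow, hw1]; ring)
  have hq0 : q ≠ 0 := by
    rintro rfl
    rw [map_zero] at hq
    exact hw0 (pow_eq_zero_iff two_ne_zero |>.1 hq.symm)
  have hl0 : (ℓ : ℚ_[ℓ]) ≠ 0 := by exact_mod_cast hℓ.out.ne_zero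
  have hl1 : (1 : ℝ) < ℓ := by exact_mod_cast hℓ.out.one_lt
  set k : ℤ := q.valuation / 2 with hk
  have hv : ‖q * ((ℓ : ℚ_[ℓ]) ^ (-k)) ^ 2‖ = (ℓ : ℝ) ^ (-(q.valuation - 2 * k)) := by
    rw [norm_mul, norm_pow, norm_zpow, Padic.norm_p, Padic.norm_eq_zpow_neg_valuation hq0,
      inv_zpow', neg_neg, ← zpow_natCast, ← zpow_mul, ← zpow_add₀ (by positivity)]
    congr 1
    push_cast
    ring
  have hle : ‖q * ((ℓ : ℚ_[ℓ]) ^ (-k)) ^ 2‖ ≤ 1 := by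
    rw [hv]
    exact zpow_le_one_of_nonpos₀ hl1.le (by omega)
  obtain ⟨d, hd⟩ : ∃ d : ℤ_[ℓ], (d : ℚ_[ℓ]) = q * ((ℓ : ℚ_[ℓ]) ^ (-k)) ^ 2 := ⟨⟨_, hle⟩, rfl⟩
  refine ⟨algebraMap ℚ_[ℓ] E ((ℓ : ℚ_[ℓ]) ^ (-k)) * w, d, ?_, ?_, ?_⟩
  · rw [map_mul, AlgEquiv.commutes, hw1]; ring
  · rw [IsScalarTower.algebraMap_apply ℤ_[ℓ] ℚ_[ℓ] E, mul_pow, ← hq, ← map_pow, ← map_mul,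
      mul_comm, ← hd]
    rfl
  · intro hdvd
    have := (PadicInt.norm_le_pow_iff_mem_span_pow
      d 2).2 (Ideal.mem_span_singleton.2 hdvd)
    rw [PadicInt.norm_def, hd, hv, zpow_le_zpow_iff_right₀ hl1] at this
    push_cast at this
    omega

end Ram

theorem sim_stabilizer_ramified_even_rank
    (ℓ : ℕ) [hℓ : Fact ℓ.Prime]
    (E : Type*) [Field E] [Algebra ℚ_[ℓ] E]
    [Algebra ℤ_[ℓ] E] [IsScalarTower ℤ_[ℓ] ℚ_[ℓ] E]
    (hdim : Module.finrank ℚ_[ℓ] E = 2)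
    (hram : ∃ 𝔪 : Ideal (integralClosure ℤ_[ℓ] E),
      𝔪.IsMaximal ∧ Ideal.span {(ℓ : integralClosure ℤ_[ℓ] E)} = 𝔪 ^ 2)
    (τ : E ≃ₐ[ℚ_[ℓ]] E) (hτ : τ ≠ AlgEquiv.refl)
    (n : ℕ) (heven : Even n) (hn : 0 < n)
    (Φ : Matrix (Fin n) (Fin n) E)
    (hΦint : ∀ i j, Φ i j ∈ integralClosure ℤ_[ℓ] E)
    (hherm : (Φ.map τ).transpose = Φ)
    (hdet : ∃ d : E, d ∈ integralClosure ℤ_[ℓ] E ∧ Φ.det * d = 1) :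
    ∀ u : ℤ_[ℓ], IsUnit u →
      ∃ g : Matrix (Fin n) (Fin n) E,
        (∀ i j, g i j ∈ integralClosure ℤ_[ℓ] E) ∧
        (∃ h : E, h ∈ integralClosure ℤ_[ℓ] E ∧ g.det * h = 1) ∧
        (g.map τ).transpose * Φ * g = algebraMap ℤ_[ℓ] E u • Φ := by
  classical
  intro u hu
  have : FiniteDimensional ℚ_[ℓ] E := Module.finite_of_finrank_pos (by omega)
  have : CharZero E :=  charZero_of_injective_algebraMap (algebraMap ℚ_[ℓ] E).injective
  have hcard : Fintype.card (E ≃ₐ[ℚ_[ℓ]] E) = 2 := by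
    refine le_antisymm (hdim ▸ AlgEquiv.card_le) ?_
    exact Fintype.one_lt_card_iff.2 ⟨τ, AlgEquiv.refl, hτ⟩
  have haut : ∀ f : E ≃ₐ[ℚ_[ℓ]] E, f = AlgEquiv.refl ∨ f = τ := by
    intro f
    by_contra! hcon
    have h3 : ({f, AlgEquiv.refl, τ} : Finset (E ≃ₐ[ℚ_[ℓ]] E)).card = 3 :=
      Finset.card_eq_three.2 ⟨_, _, _, hcon.1, hcon.2, hτ.symm, rfl⟩
    have := Finset.card_le_univ ({f, AlgEquiv.refl, τ} : Finset (E ≃ₐ[ℚ_[ℓ]] E))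
    omega
  have hττ : ∀ x, τ (τ x) = x := by
    rcases haut (τ.trans τ) with h | h
    · intro x; exact DFunLike.congr_fun h x
    · exfalso
      apply hτ
      ext x
      have := DFunLike.congr_fun h x
      exact τ.injective this
  have : IsGalois ℚ_[ℓ] E := IsGalois.of_card_aut_eq_finrank _ _ (by
    rw [Nat.card_eq_fintype_card, hcard, hdim])
  have hfixE : ∀ x, τ x = x → ∃ q : ℚ_[ℓ], algebraMap ℚ_[ℓ] E q = x := by
    intro x hx
    have := (IsGalois.mem_bot_iff_fixed (F := ℚ_[ℓ]) (E := E) x).2 (by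
      intro f
      rcases haut f with rfl | rfl
      · rfl
      · exact hx)
    exact IntermediateField.mem_bot.1 this
  have hτint : ∀ x, x ∈ integralClosure ℤ_[ℓ] E → τ x ∈ integralClosure ℤ_[ℓ] E := by
    intro x hx
    exact IsIntegral.map (τ.restrictScalars ℤ_[ℓ]) hx
  have hinjE : Function.Injective (algebraMap ℤ_[ℓ] E) := by
    rw [IsScalarTower.algebraMap_eq ℤ_[ℓ] ℚ_[ℓ] E]
    exact (algebraMap ℚ_[ℓ] E).injective.comp (IsFractionRing.injective ℤ_[ℓ] ℚ_[ℓ])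
  have hτA : ∀ a : ℤ_[ℓ], τ (algebraMap ℤ_[ℓ] E a) = algebraMap ℤ_[ℓ] E a := by
    intro a
    rw [IsScalarTower.algebraMap_apply ℤ_[ℓ] ℚ_[ℓ] E, AlgEquiv.commutes]
  letI : StarRing (integralClosure ℤ_[ℓ] E) :=
    { star := fun x => ⟨τ x, hτint x x.2⟩
      star_involutive := fun x => Subtype.ext (hττ x)
      star_mul := fun x y => Subtype.ext (by simp [mul_comm])
      star_add := fun x y => Subtype.ext (by simp) }
  have hstar : ∀ x : integralClosure ℤ_[ℓ] E, ((star x : integralClosure ℤ_[ℓ] E) : E) = τ x :=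
    fun x => rfl
  obtain ⟨𝔪, h𝔪, hram⟩ := hram
  have : IsLocalRing (integralClosure ℤ_[ℓ] E) := by
    refine IsLocalRing.of_unique_max_ideal ⟨𝔪, h𝔪, ?_⟩
    intro I hI
    have : I.IsMaximal := hI
    have h1 : (I.comap (algebraMap ℤ_[ℓ] (integralClosure ℤ_[ℓ] E))).IsMaximal :=
      Ideal.isMaximal_comap_of_isIntegral_of_isMaximal I
    have h2 := IsLocalRing.eq_maximalIdeal h1
    have h3 : (ℓ : ℤ_[ℓ]) ∈ I.comap (algebraMap ℤ_[ℓ] (integralClosure ℤ_[ℓ] E)) := by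
      rw [h2, PadicInt.maximalIdeal_eq_span_p]
      exact Ideal.mem_span_singleton_self _
    rw [Ideal.mem_comap, map_natCast] at h3
    have h4 : 𝔪 ^ 2 ≤ I := by
      rw [← hram, Ideal.span_singleton_le_iff_mem]; exact h3
    have h5 : 𝔪 ≤ I := hI.isPrime.le_of_pow_le h4
    exact (h𝔪.eq_of_le hI.ne_top h5).symm
  rw [IsLocalRing.eq_maximalIdeal h𝔪] at hram
  have hinj : Function.Injective (algebraMap ℤ_[ℓ] (integralClosure ℤ_[ℓ] E)) := by
    intro a b hab
    exact hinjE (congrArg Subtype.val hab)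
  have hA : ∀ a : ℤ_[ℓ], star (algebraMap ℤ_[ℓ] (integralClosure ℤ_[ℓ] E) a)
      = algebraMap ℤ_[ℓ] (integralClosure ℤ_[ℓ] E) a := fun a => Subtype.ext (hτA a)
  have hfix : ∀ r : integralClosure ℤ_[ℓ] E, star r = r →
      ∃ a : ℤ_[ℓ], algebraMap ℤ_[ℓ] (integralClosure ℤ_[ℓ] E) a = r := by
    intro r hr
    obtain ⟨q, hq⟩ := hfixE r (congrArg Subtype.val hr)
    have hqi : IsIntegral ℤ_[ℓ] q := by
      have : IsIntegral ℤ_[ℓ] (algebraMap ℚ_[ℓ] E q) := by rw [hq]; exact r.2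
      exact (isIntegral_algebraMap_iff (algebraMap ℚ_[ℓ] E).injective).1 this
    obtain ⟨a, ha⟩ := IsIntegrallyClosed.isIntegral_iff.1 hqi
    refine ⟨a, Subtype.ext ?_⟩
    change algebraMap ℤ_[ℓ] E a = r
    rw [IsScalarTower.algebraMap_apply ℤ_[ℓ] ℚ_[ℓ] E, ha, hq]
  have hnu := ram_not_unit hinj hA hfix hram
  have hdiag : ∀ c : ℤ_[ℓ], IsUnit c → ∃ x y : integralClosure ℤ_[ℓ] E,
      star x * x + algebraMap ℤ_[ℓ] (integralClosure ℤ_[ℓ] E) c * (star y * y)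
        = algebraMap ℤ_[ℓ] (integralClosure ℤ_[ℓ] E) u := by
    intro c hc
    by_cases h2 : ℓ = 2
    · subst h2
      obtain ⟨w, d, hw, hwd, hd4⟩ := exists_normalized τ hτ hττ hfixE two_ne_zero
      have hwint : w ∈ integralClosure ℤ_[2] E :=
        IsIntegral.of_pow two_pos (hwd ▸ isIntegral_algebraMap)
      have hd1 : ¬ (2 : ℤ_[2]) ^ 2 ∣ d - 1 := by
        rintro ⟨e, he⟩
        have hωint : (1 + w) / 2 ∈ integralClosure ℤ_[2] E := by
          refine ⟨Polynomial.X ^ 2 - Polynomial.X - Polynomial.C e, ?_, ?_⟩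
          · monicity!
          · have he' := congrArg (algebraMap ℤ_[2] E) he
            simp only [map_sub, map_mul, map_pow, map_ofNat, map_one] at he'
            simp
            field_simp
            linear_combination hwd + he'
        apply hnu ⟨(1 + w) / 2, hωint⟩
        have hsub : (⟨(1 + w) / 2, hωint⟩ : integralClosure ℤ_[2] E)
            - star ⟨(1 + w) / 2, hωint⟩ = ⟨w, hwint⟩ := by
          apply Subtype.ext
          change (1 + w) / 2 - τ ((1 + w) / 2) = w
          rw [map_div₀, map_add, map_one, hw, map_ofNat]
          ring
        rw [hsub]
        have hdu : IsUnit d := by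
          by_contra hcon
          obtain ⟨d', rfl⟩ := padic_half d hcon
          have h1 : (2 : ℤ_[2]) ∣ 1 := ⟨d' - 2 * e, by linear_combination -he⟩
          have h3 : IsUnit (2 : ℤ_[2]) := isUnit_of_dvd_one h1
          have := PadicInt.p_nonunit (p := 2)
          exact this (by exact_mod_cast h3)
        have hsq : (⟨w, hwint⟩ : integralClosure ℤ_[2] E) ^ 2
            = algebraMap ℤ_[2] (integralClosure ℤ_[2] E) d := Subtype.ext hwd
        exact (isUnit_pow_iff two_ne_zero).1 (hsq ▸ hdu.map _)
      have hcase : ∀ a : ℤ_[2], (PadicInt.toZModPow 3 a = 0 ∨ PadicInt.toZModPow 3 a = 4) →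
          (2 : ℤ_[2]) ^ 2 ∣ a := by
        intro a ha
        have : ∃ b : ℤ_[2], PadicInt.toZModPow 3 (a - 4 * b) = 0 := by
          rcases ha with ha | ha
          · exact ⟨0, by simp [ha]⟩
          · exact ⟨1, by rw [map_sub, ha, mul_one, map_ofNat]; exact sub_self _⟩
        obtain ⟨b, hb⟩ := this
        have hb' : a - 4 * b ∈ RingHom.ker (PadicInt.toZModPow (p := 2) 3) := hb
        rw [PadicInt.ker_toZModPow, Ideal.mem_span_singleton] at hb'
        obtain ⟨k, hk⟩ := hb'
        push_cast at hk
        exact ⟨b + 2 * k, by linear_combination hk⟩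
      have hd8 := zmod8_cases (PadicInt.toZModPow 3 d)
        (fun h => hd4 (by exact_mod_cast hcase d (Or.inl h)))
        (fun h => hd4 (by exact_mod_cast hcase d (Or.inr h)))
        (fun h => hd1 (hcase _ (Or.inl (by rw [map_sub, map_one, h]; rfl))))
        (fun h => hd1 (hcase _ (Or.inr (by rw [map_sub, map_one, h]; rfl))))
      obtain ⟨x, y, z, t, h⟩ := padic_two_diag d c u hc hu hd8
      refine ⟨algebraMap _ _ x + algebraMap _ _ y * ⟨w, hwint⟩,
        algebraMap _ _ z + algebraMap _ _ t * ⟨w, hwint⟩, ?_⟩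
      have hsw : star (⟨w, hwint⟩ : integralClosure ℤ_[2] E) = -⟨w, hwint⟩ := Subtype.ext hw
      have hsq : (⟨w, hwint⟩ : integralClosure ℤ_[2] E) ^ 2
            = algebraMap ℤ_[2] (integralClosure ℤ_[2] E) d := Subtype.ext hwd
      rw [← h]
      simp only [star_add, star_mul', hA, hsw, map_add, map_sub, map_mul]
      generalize (⟨w, hwint⟩ : integralClosure ℤ_[2] E) = W at hsq
      generalize algebraMap ℤ_[2] (integralClosure ℤ_[2] E) = F at *
      linear_combination (-(F y) ^ 2 - F c * (F t) ^ 2) * hsq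
    · obtain ⟨x, y, h⟩ := padic_odd_diag h2 u c hu hc
      refine ⟨algebraMap _ _ x, algebraMap _ _ y, ?_⟩
      rw [hA, hA, ← h]
      simp only [map_add, map_mul]
  let Ψ : Matrix (Fin n) (Fin n) (integralClosure ℤ_[ℓ] E) := Matrix.of fun i j => ⟨Φ i j, hΦint i j⟩
  have hΨΦ : Ψ.map (algebraMap (integralClosure ℤ_[ℓ] E) E) = Φ := by ext; rfl
  have hdetmap : ∀ M : Matrix (Fin n) (Fin n) (integralClosure ℤ_[ℓ] E),
      (M.map (algebraMap (integralClosure ℤ_[ℓ] E) E)).det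
        = algebraMap (integralClosure ℤ_[ℓ] E) E M.det := by
    intro M
    rw [RingHom.map_det]; rfl
  have hΨu : IsUnit Ψ := by
    obtain ⟨d, hd, hdd⟩ := hdet
    rw [Matrix.isUnit_iff_isUnit_det]
    refine IsUnit.of_mul_eq_one ⟨d, hd⟩ (Subtype.ext ?_)
    rw [← hΨΦ, hdetmap] at hdd
    exact hdd
  have hΨh : Ψ.conjTranspose = Ψ := by
    ext i j
    exact congrFun (congrFun hherm i) j
  obtain ⟨g, k, hgk, hg⟩ := (sim_main hinj hA hfix padic_half u hu hdiag (padic_plane u hu) n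
    (Fin n) Ψ (Fintype.card_fin n) hΨh hΨu).1 heven
  refine ⟨g.map (algebraMap (integralClosure ℤ_[ℓ] E) E), fun i j => (g i j).2,
    ⟨algebraMap (integralClosure ℤ_[ℓ] E) E k.det, k.det.2, ?_⟩, ?_⟩
  · rw [hdetmap, ← map_mul, ← Matrix.det_mul, hgk, Matrix.det_one, map_one]
  · have h1 := congrArg (fun M => M.map (algebraMap (integralClosure ℤ_[ℓ] E) E)) hg
    simp only [Matrix.map_mul] at h1
    rw [hΨΦ] at h1
    have h3 : (g.conjTranspose).map (algebraMap (integralClosure ℤ_[ℓ] E) E)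
        = ((g.map (algebraMap (integralClosure ℤ_[ℓ] E) E)).map τ).transpose := by
      ext i j; rfl
    rw [h3] at h1
    rw [h1]
    ext i j
    rfl
end

section
/- For all integers 0 ≤ t ≤ n, the polynomial ∏_{j=1}^{n−t} (X^j − (−1)^j) · ∏_{k=1}^{t} (X^k − (−1)^k) divides the polynomial ∏_{i=1}^{n} (X^i − (−1)^i) in the ring ℤ[X] of polynomials with integer coefficients. -/
open Polynomial

lemma prod_pow_sub_dvd {R : Type*} [CommRing R] (a b : R) (m t : ℕ) :
    (∏ j ∈ Finset.range m, (a ^ (j + 1) - b ^ (j + 1))) *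
      (∏ k ∈ Finset.range t, (a ^ (k + 1) - b ^ (k + 1))) ∣
    ∏ i ∈ Finset.range (m + t), (a ^ (i + 1) - b ^ (i + 1)) := by
  induction m generalizing t with
  | zero => simp
  | succ m ihm =>
    induction t with
    | zero => simp
    | succ t iht =>
      obtain ⟨c, hc⟩ := ihm (t + 1)
      obtain ⟨d, hd⟩ := iht
      have e1 : m + 1 + t = m + (t + 1) := by ring
      rw [e1] at hd
      have e2 : m + 1 + (t + 1) = (m + (t + 1)) + 1 := by ring
      rw [e2, Finset.prod_range_succ _ (m + (t + 1))]
      have key : a ^ (m + (t + 1) + 1) - b ^ (m + (t + 1) + 1) =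
          a ^ (t + 1) * (a ^ (m + 1) - b ^ (m + 1)) +
            b ^ (m + 1) * (a ^ (t + 1) - b ^ (t + 1)) := by ring
      rw [key, mul_add]
      apply dvd_add
      · rw [hc, Finset.prod_range_succ _ m]
        exact ⟨c * a ^ (t + 1), by ring⟩
      · rw [hd, Finset.prod_range_succ _ t]
        exact ⟨d * b ^ (m + 1), by ring⟩

/-- **Integrality of the parahoric volume ratio `λ_p(n,t)`** (Remark after
Proposition `compare`): for `0 ≤ t ≤ n`, the product
`∏_{j=1}^{n-t} (X^j - (-1)^j) · ∏_{k=1}^{t} (X^k - (-1)^k)` divides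
`∏_{i=1}^{n} (X^i - (-1)^i)` in `ℤ[X]`. -/
theorem parahoric_volume_ratio_integral (n t : ℕ) (ht : t ≤ n) :
    (∏ j ∈ Finset.range (n - t), ((X : ℤ[X]) ^ (j + 1) - (-1) ^ (j + 1))) *
      (∏ k ∈ Finset.range t, ((X : ℤ[X]) ^ (k + 1) - (-1) ^ (k + 1))) ∣
    ∏ i ∈ Finset.range n, ((X : ℤ[X]) ^ (i + 1) - (-1) ^ (i + 1)) := by
  have h := prod_pow_sub_dvd (X : ℤ[X]) (-1) (n - t) t
  rwa [Nat.sub_add_cancel ht] at h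
end
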